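/- arXiv:1512.04424 — 8 statements merged into one kernel-verified Lean document; each statement's English description precedes it below -/
import Mathlib

section
/- Let X ⊆ ℝ be a compact (f_n)-microscopic set, where (f_n) satisfies the standard conditions. Then for every k ∈ ℕ and every ε ∈ (0,1), X can be covered by finitely many intervals (I_n)_{k < n ≤ l} for some l, with |I_n| ≤ f_n(ε) for each n with k < n ≤ l. -/
open Set MeasureTheory

/-- `M` can be covered by a sequence of intervals whose `k`-th length is at most `len k`. -/
def IntervalCover (M : Set ℝ) (len : ℕ → ℝ) : Prop :=
  ∃ a b : ℕ → ℝ, M ⊆ ⋃ k, Set.Icc (a k) (b k) ∧ ∀ k, b k - a k ≤ len k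

def Microscopic (M : Set ℝ) : Prop :=
  ∀ ε : ℝ, 0 < ε → ε < 1 → IntervalCover M (fun k => ε ^ k)

def Nanoscopic (M : Set ℝ) : Prop :=
  ∀ ε : ℝ, 0 < ε → ε < 1 → IntervalCover M (fun k => ε ^ (2 ^ k))

def Picoscopic (M : Set ℝ) : Prop :=
  ∀ ε : ℝ, 0 < ε → ε < 1 → IntervalCover M (fun k => ε ^ (Nat.factorial (k + 1)))

def FnMicroscopic (f : ℕ → ℝ → ℝ) (M : Set ℝ) : Prop :=
  ∀ ε : ℝ, 0 < ε → ε < 1 → IntervalCover M (fun k => f k ε)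

/-- The standard conditions on a sequence of functions generating generalized microscopic sets. -/
def StandardConditions (f : ℕ → ℝ → ℝ) : Prop :=
  (∀ n, ∀ x ∈ Set.Ioo (0:ℝ) 1, f n x ∈ Set.Ioo (0:ℝ) 1) ∧
  (∀ n, StrictMonoOn (f n) (Set.Ioo (0:ℝ) 1)) ∧
  (∀ n, ∀ x ∈ Set.Ioo (0:ℝ) 1, f (n + 1) x ≤ f n x) ∧
  (∀ n, Filter.Tendsto (f n) (nhdsWithin 0 (Set.Ioi 0)) (nhds 0)) ∧
  (∃ x₀ : ℝ, 0 < x₀ ∧ ∀ x : ℝ, 0 < x → x < x₀ → Summable fun n => f n x)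

def StrongMeasureZero (B : Set ℝ) : Prop :=
  ∀ ε : ℕ → ℝ, (∀ k, 0 < ε k) → IntervalCover B ε

def IsFsigma (F : Set ℝ) : Prop :=
  ∃ C : ℕ → Set ℝ, (∀ n, IsClosed (C n)) ∧ F = ⋃ n, C n

/-- `A` can be covered by an `Fσ` set which is `(f n)`-microscopic. -/
def MicroStar (f : ℕ → ℝ → ℝ) (A : Set ℝ) : Prop :=
  ∃ F : Set ℝ, IsFsigma F ∧ FnMicroscopic f F ∧ A ⊆ F

/-- `m`-`(f n)`-microscopic sets. -/
def MFnMicroscopic (f : ℕ → ℝ → ℝ) (m : ℕ) (M : Set ℝ) : Prop :=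
  ∀ ε : ℝ, 0 < ε → ε < 1 → ∃ a b : ℕ → ℝ, M ⊆ ⋃ k, Set.Icc (a k) (b k) ∧
    ∀ k : ℕ, ∀ j < m, b (m * k + j) - a (m * k + j) ≤ f k ε

def TwoNanoscopic (M : Set ℝ) : Prop :=
  MFnMicroscopic (fun k ε => ε ^ (2 ^ k)) 2 M

theorem aux_anti {f : ℕ → ℝ → ℝ} (hf : StandardConditions f) {x : ℝ} (hx : x ∈ Set.Ioo (0:ℝ) 1) :
    Antitone (fun n => f n x) :=
  antitone_nat_of_succ_le (fun n => hf.2.2.1 n x hx)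

theorem aux_shift {f : ℕ → ℝ → ℝ} (hf : StandardConditions f) :
    StandardConditions (fun n => f (n + 1)) := by
  obtain ⟨h1, h2, h3, h4, x₀, h5, h6⟩ := hf
  refine ⟨fun n => h1 _, fun n => h2 _, fun n => h3 _, fun n => h4 _, x₀, h5, fun x hx hx' => ?_⟩
  exact (summable_nat_add_iff (f := fun n => f n x) 1).2 (h6 x hx hx')

theorem aux_step {f : ℕ → ℝ → ℝ} (hf : StandardConditions f) {X : Set ℝ}
    (hXc : IsCompact X) (hX : FnMicroscopic f X) : FnMicroscopic (fun n => f (n + 1)) X := by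
  intro ε hε0 hε1
  have hε : ε ∈ Set.Ioo (0:ℝ) 1 := ⟨hε0, hε1⟩
  rcases X.eq_empty_or_nonempty with rfl | ⟨x0, hx0⟩
  · exact ⟨fun _ => 0, fun _ => 0, by simp, fun k => by simpa using (hf.1 (k+1) ε hε).1.le⟩
  obtain ⟨R, hR⟩ := hXc.isBounded.exists_norm_le
  obtain ⟨η, hη⟩ : ∃ η, η = f 1 ε / 4 := ⟨_, rfl⟩
  have hη0 : 0 < η := by have := (hf.1 1 ε hε).1; linarith
  set T : Finset ℤ := Finset.Icc ⌊-R / η⌋ ⌊R / η⌋ with hT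
  obtain ⟨M, hM⟩ : ∃ M, M = T.card := ⟨_, rfl⟩
  obtain ⟨δ, hδ0, hδε, hδη, hδM⟩ : ∃ δ, 0 < δ ∧ δ < ε ∧ f 0 δ < η ∧ f 0 δ < f M ε := by
    have e1 := (hf.2.2.2.1 0).eventually (gt_mem_nhds hη0)
    have e2 := (hf.2.2.2.1 0).eventually (gt_mem_nhds (hf.1 M ε hε).1)
    have e3 : ∀ᶠ x in nhdsWithin (0:ℝ) (Set.Ioi 0), x ∈ Set.Ioo 0 ε := Ioo_mem_nhdsGT hε0
    obtain ⟨δ, a, b, c⟩ := (e1.and (e2.and e3)).exists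
    exact ⟨δ, c.1, c.2, a, b⟩
  have hδ : δ ∈ Set.Ioo (0:ℝ) 1 := ⟨hδ0, hδε.trans hε1⟩
  obtain ⟨a, b, c, hab, hlen, hc⟩ : ∃ a b c : ℕ → ℝ, X ⊆ ⋃ k, Set.Icc (a k) (b k) ∧
      (∀ k, b k - a k ≤ f k δ) ∧ ∀ k, c k ∈ X ∧ c k ∈ Set.Icc (a k) (b k) := by
    obtain ⟨a, b, h1, h2⟩ := hX δ hδ0 hδ.2
    have : ∀ k, ∃ a' b' c', X ∩ Set.Icc (a k) (b k) ⊆ Set.Icc a' b' ∧ b' - a' ≤ f k δ ∧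
        c' ∈ X ∧ c' ∈ Set.Icc a' b' := by
      intro k
      rcases (X ∩ Set.Icc (a k) (b k)).eq_empty_or_nonempty with h | ⟨c, hc⟩
      · refine ⟨x0, x0, x0, by simp [h], by simpa using (hf.1 k δ hδ).1.le, hx0, by simp⟩
      · exact ⟨a k, b k, c, Set.inter_subset_right, h2 k, hc.1, hc.2⟩
    choose a' b' c' h using this
    refine ⟨a', b', c', fun x hx => ?_, fun k => (h k).2.1, fun k => (h k).2.2⟩
    obtain ⟨k, hk⟩ := Set.mem_iUnion.1 (h1 hx)
    exact Set.mem_iUnion.2 ⟨k, (h k).1 ⟨hx, hk⟩⟩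
  obtain ⟨i, j, hij, hjM, hcc⟩ : ∃ i j, i < j ∧ j ≤ M ∧ |c i - c j| < η := by
    have hmaps : ∀ n ∈ Finset.range (M + 1), ⌊c n / η⌋ ∈ T := by
      intro n _
      have := abs_le.1 (hR _ (hc n).1)
      rw [hT, Finset.mem_Icc]
      exact ⟨Int.floor_le_floor (by gcongr; exact this.1),
        Int.floor_le_floor (by gcongr; exact this.2)⟩
    have key : ∀ i j, ⌊c i / η⌋ = ⌊c j / η⌋ → |c i - c j| < η := by
      intro i j h
      have := Int.abs_sub_lt_one_of_floor_eq_floor h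
      rwa [← sub_div, abs_div, abs_of_pos hη0, div_lt_one hη0] at this
    obtain ⟨i, hi, j, hj, hne, he⟩ := Finset.exists_ne_map_eq_of_card_lt_of_maps_to
      (by rw [Finset.card_range]; omega) hmaps
    rw [Finset.mem_range] at hi hj
    rcases lt_or_gt_of_ne hne with h | h
    · exact ⟨i, j, h, by omega, key _ _ he⟩
    · exact ⟨j, i, h, by omega, key _ _ he.symm⟩
  have hsmall : ∀ n, b n - a n < η := fun n =>
    ((hlen n).trans (aux_anti hf hδ (Nat.zero_le n))).trans_lt hδη
  have hsmall' : ∀ n m, m ≤ M → b n - a n ≤ f m ε := fun n m hm =>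
    (((hlen n).trans (aux_anti hf hδ (Nat.zero_le n))).trans hδM.le).trans (aux_anti hf hε hm)
  let σ : ℕ → ℕ := fun n => if n = i then 0 else if n = j then (if i = 1 then 0 else 1) else n
  let A : ℕ → ℝ := fun n => if n = 1 then c i - 2 * η else a (σ n)
  let B : ℕ → ℝ := fun n => if n = 1 then c i + 2 * η else b (σ n)
  have hAB : ∀ n, 1 ≤ n → B n - A n ≤ f n ε := by
    intro n hn
    by_cases h1 : n = 1
    · subst h1; simp only [A, B, if_true]; linarith
    simp only [A, B, h1, if_false]
    by_cases hnM : n ≤ M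
    · exact hsmall' _ _ hnM
    · have : σ n = n := by
        simp only [σ]; rw [if_neg (by omega), if_neg (by omega)]
      rw [this]
      exact (hlen n).trans ((hf.2.1 n).monotoneOn hδ hε hδε.le)
  have hcov : ∀ x ∈ X, ∃ n, 1 ≤ n ∧ x ∈ Set.Icc (A n) (B n) := by
    intro x hx
    obtain ⟨n, hn⟩ := Set.mem_iUnion.1 (hab hx)
    have hs : ∀ m, 2 ≤ m → σ m = n → ∃ n, 1 ≤ n ∧ x ∈ Set.Icc (A n) (B n) := by
      intro m hm h
      refine ⟨m, by omega, ?_⟩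
      simp only [A, B, if_neg (show m ≠ 1 by omega), h]
      exact hn
    by_cases h : n = i ∨ n = j
    · refine ⟨1, le_rfl, ?_⟩
      have hcn : |c i - c n| < η := by
        rcases h with h | h <;> subst h
        · simpa using hη0
        · exact hcc
      have h1 := abs_lt.1 hcn
      have h2 := (hc n).2
      have h3 := hsmall n
      simp only [A, B, if_true]
      constructor <;> linarith [hn.1, hn.2, h2.1, h2.2, h1.1, h1.2]
    · by_cases h2 : 2 ≤ n
      · exact hs n h2 (by simp only [σ]; rw [if_neg (by omega), if_neg (by omega)])
      by_cases h0 : n = 0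
      · by_cases hi : i = 1
        · exact hs j (by omega) (by
            simp only [σ]; rw [if_neg (by omega), if_pos trivial, if_pos hi, h0])
        · exact hs i (by omega) (by simp only [σ]; rw [if_pos trivial, h0])
      · exact hs j (by omega) (by
          simp only [σ]; rw [if_neg (by omega), if_pos trivial, if_neg (by omega)]; omega)
  refine ⟨fun n => A (n + 1), fun n => B (n + 1), fun x hx => ?_, fun n => hAB _ (by omega)⟩
  obtain ⟨n, hn, hxn⟩ := hcov x hx
  refine Set.mem_iUnion.2 ⟨n - 1, ?_⟩
  simpa [Nat.sub_add_cancel hn] using hxn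

theorem aux_iter {f : ℕ → ℝ → ℝ} (hf : StandardConditions f) {X : Set ℝ}
    (hXc : IsCompact X) (hX : FnMicroscopic f X) (m : ℕ) :
    StandardConditions (fun n => f (n + m)) ∧ FnMicroscopic (fun n => f (n + m)) X := by
  induction m with
  | zero => exact ⟨hf, hX⟩
  | succ m ih =>
    have h1 := aux_shift ih.1
    have h2 := aux_step ih.1 hXc ih.2
    have e : (fun n => f (n + (m + 1))) = (fun n => f (n + 1 + m)) := by
      funext n; congr 1; omega
    rw [e]; exact ⟨h1, h2⟩

theorem stmt6 (f : ℕ → ℝ → ℝ) (hf : StandardConditions f)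
    (X : Set ℝ) (hXc : IsCompact X) (hX : FnMicroscopic f X)
    (k : ℕ) (ε : ℝ) (hε0 : 0 < ε) (hε1 : ε < 1) :
    ∃ l : ℕ, ∃ a b : ℕ → ℝ, X ⊆ ⋃ n ∈ Set.Ioc k l, Set.Icc (a n) (b n) ∧
      ∀ n ∈ Set.Ioc k l, b n - a n ≤ f n ε := by
  have hε : ε ∈ Set.Ioo (0:ℝ) 1 := ⟨hε0, hε1⟩
  have hε' : ε / 2 ∈ Set.Ioo (0:ℝ) 1 := ⟨by linarith, by linarith⟩
  obtain ⟨a, b, hab, hlen⟩ := (aux_iter hf hXc hX (k + 1)).2 (ε / 2) hε'.1 hε'.2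
  let d : ℕ → ℝ := fun n => (f (n + (k + 1)) ε - f (n + (k + 1)) (ε / 2)) / 2
  have hd : ∀ n, 0 < d n := fun n => by
    have := hf.2.1 (n + (k + 1)) hε' hε (by linarith)
    simp only [d]; linarith
  obtain ⟨t, ht⟩ := hXc.elim_finite_subcover (fun n => Set.Ioo (a n - d n) (b n + d n))
    (fun n => isOpen_Ioo) (hab.trans (Set.iUnion_mono fun n x hx =>
      ⟨by linarith [hd n, hx.1], by linarith [hd n, hx.2]⟩))
  refine ⟨t.sup id + (k + 1), fun n => a (n - (k + 1)) - d (n - (k + 1)),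
    fun n => b (n - (k + 1)) + d (n - (k + 1)), fun x hx => ?_, fun n hn => ?_⟩
  · obtain ⟨n, hn, hxn⟩ := Set.mem_iUnion₂.1 (ht hx)
    have hle : n ≤ t.sup id := Finset.le_sup (f := id) hn
    refine Set.mem_iUnion₂.2 ⟨n + (k + 1), ⟨by omega, by omega⟩, ?_⟩
    simp only [Nat.add_sub_cancel]
    exact Set.Ioo_subset_Icc_self hxn
  · obtain ⟨m, rfl⟩ : ∃ m, n = m + (k + 1) := ⟨n - (k + 1), by have := hn.1; omega⟩
    have := hlen m
    simp only [Nat.add_sub_cancel, d]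
    linarith
end

section
/- Let (f_n) satisfy the standard conditions. The family of all subsets of ℝ that can be covered by an F_σ set which is (f_n)-microscopic forms a σ-ideal: it contains the empty set, is closed under subsets, and is closed under countable unions. -/
open Set MeasureTheory

open Set MeasureTheory Filter Topology in
/-- every tail of the sequence suffices -/
def TailMic (f : ℕ → ℝ → ℝ) (L : Set ℝ) : Prop :=
  ∀ N : ℕ, ∀ ε : ℝ, 0 < ε → ε < 1 → IntervalCover L (fun k => f (N + k) ε)

lemma anti_f {f : ℕ → ℝ → ℝ} (hf : StandardConditions f) {x : ℝ} (hx : x ∈ Set.Ioo (0:ℝ) 1)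
    {m n : ℕ} (h : m ≤ n) : f n x ≤ f m x :=
  antitone_nat_of_succ_le (f := fun n => f n x) (fun n => hf.2.2.1 n x hx) h

lemma tail_finite {f : ℕ → ℝ → ℝ} (hf : StandardConditions f) {L : Set ℝ} (hL : IsCompact L)
    (hT : TailMic f L) (ε : ℝ) (h0 : 0 < ε) (h1 : ε < 1) (N : ℕ) :
    ∃ (M : ℕ) (a b : ℕ → ℝ), (∀ y ∈ L, ∃ k < M, y ∈ Set.Icc (a k) (b k)) ∧
      ∀ k, b k - a k ≤ f (N + k) ε := by
  obtain ⟨a, b, hc, hl⟩ := hT N (ε / 2) (by linarith) (by linarith)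
  have hgap : ∀ k, f (N + k) (ε / 2) < f (N + k) ε := fun k =>
    hf.2.1 (N + k) ⟨by linarith, by linarith⟩ ⟨h0, h1⟩ (by linarith)
  set η : ℕ → ℝ := fun k => (f (N + k) ε - f (N + k) (ε / 2)) / 2 with hη
  have hηp : ∀ k, 0 < η k := fun k => by have := hgap k; simp only [hη]; linarith
  obtain ⟨t, ht⟩ := hL.elim_finite_subcover (fun k => Set.Ioo (a k - η k) (b k + η k))
    (fun k => isOpen_Ioo) (fun y hy => by
      obtain ⟨k, hk⟩ := Set.mem_iUnion.1 (hc hy)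
      exact Set.mem_iUnion.2 ⟨k, by have := hηp k; linarith [hk.1], by
        have := hηp k; linarith [hk.2]⟩)
  refine ⟨t.sup id + 1, fun k => a k - η k, fun k => b k + η k, fun y hy => ?_, fun k => ?_⟩
  · have := ht hy
    simp only [Set.mem_iUnion] at this
    obtain ⟨k, hk, hy⟩ := this
    exact ⟨k, Nat.lt_succ_of_le (Finset.le_sup (f := id) hk), Set.Ioo_subset_Icc_self hy⟩
  · have := hl k
    simp only [hη] at *
    linarith

lemma union_mic {f : ℕ → ℝ → ℝ} (hf : StandardConditions f) (L : ℕ → Set ℝ)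
    (hL : ∀ i, IsCompact (L i)) (hT : ∀ i, TailMic f (L i)) : FnMicroscopic f (⋃ i, L i) := by
  intro ε h0 h1
  choose M a b hc hl using fun i N => tail_finite hf (hL i) (hT i) ε h0 h1 N
  let s : ℕ → ℕ := fun i => Nat.rec 0 (fun i s => s + M i s) i
  have hs : ∀ i, s (i + 1) = s i + M i (s i) := fun i => rfl
  have hmono : Monotone s := monotone_nat_of_le_succ (fun i => by rw [hs]; omega)
  have huniq : ∀ i i' k k', k < M i (s i) → k' < M i' (s i') → s i + k = s i' + k' →
      ¬ i < i' := by
    intro i i' k k' hk hk' he hlt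
    have := hmono (Nat.succ_le_of_lt hlt)
    rw [Nat.succ_eq_add_one, hs] at this
    omega
  have key : ∀ n, ∃ α β : ℝ, β - α ≤ f n ε ∧ ∀ i k, k < M i (s i) → s i + k = n →
      α = a i (s i) k ∧ β = b i (s i) k := by
    intro n
    by_cases h : ∃ i k, k < M i (s i) ∧ s i + k = n
    · obtain ⟨i, k, hk, rfl⟩ := h
      refine ⟨a i (s i) k, b i (s i) k, hl i (s i) k, fun i' k' hk' he => ?_⟩
      have hi : i = i' := le_antisymm (not_lt.1 (huniq i' i k' k hk' hk he))
        (not_lt.1 (huniq i i' k k' hk hk' he.symm))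
      subst hi
      have : k' = k := by omega
      subst this
      exact ⟨rfl, rfl⟩
    · refine ⟨0, 0, by simpa using (hf.1 n ε ⟨h0, h1⟩).1.le, fun i k hk he => ?_⟩
      exact absurd ⟨i, k, hk, he⟩ h
  choose α β h2 h3 using key
  refine ⟨α, β, fun y hy => ?_, h2⟩
  obtain ⟨i, hi⟩ := Set.mem_iUnion.1 hy
  obtain ⟨k, hk, hyk⟩ := hc i (s i) y hi
  refine Set.mem_iUnion.2 ⟨s i + k, ?_⟩
  obtain ⟨e1, e2⟩ := h3 _ i k hk rfl
  rw [e1, e2]; exact hyk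

lemma tail_singleton {f : ℕ → ℝ → ℝ} (hf : StandardConditions f) (x : ℝ) : TailMic f {x} := by
  intro N ε h0 h1
  refine ⟨fun _ => x, fun _ => x, fun y hy => Set.mem_iUnion.2 ⟨0, ?_⟩, fun k => ?_⟩
  · rw [Set.mem_singleton_iff.1 hy]; simp
  · simpa using (hf.1 (N + k) ε ⟨h0, h1⟩).1.le

open Filter Topology in
lemma exists_bad {f : ℕ → ℝ → ℝ} (hf : StandardConditions f) {K : Set ℝ} (hK : IsCompact K)
    (hne : K.Nonempty) (hm : FnMicroscopic f K) :
    ∃ x : ℝ, ∀ L ⊆ K, IsClosed L → x ∉ L → TailMic f L := by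
  classical
  have hm' : ∀ δ : ℝ, ∃ a b : ℕ → ℝ, 0 < δ → δ < 1 →
      K ⊆ ⋃ k, Set.Icc (a k) (b k) ∧ ∀ k, b k - a k ≤ f k δ := by
    intro δ
    by_cases h : 0 < δ ∧ δ < 1
    · obtain ⟨a, b, h⟩ := hm δ h.1 h.2
      exact ⟨a, b, fun _ _ => h⟩
    · exact ⟨0, 0, fun h1 h2 => absurd ⟨h1, h2⟩ h⟩
  choose a b hab using hm'
  have hc : ∀ k δ, ∃ c ∈ K, ∀ y ∈ K, y ∈ Set.Icc (a δ k) (b δ k) →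
      c ∈ Set.Icc (a δ k) (b δ k) := by
    intro k δ
    by_cases h : ∃ y ∈ K, y ∈ Set.Icc (a δ k) (b δ k)
    · obtain ⟨y, hy, hy'⟩ := h
      exact ⟨y, hy, fun _ _ _ => hy'⟩
    · obtain ⟨y, hy⟩ := hne
      exact ⟨y, hy, fun z hz hz' => absurd ⟨z, hz, hz'⟩ h⟩
  choose c hcK hc using hc
  let U : Ultrafilter ℝ := Ultrafilter.of (𝓝[>] (0:ℝ))
  have hU : (U : Filter ℝ) ≤ 𝓝[>] (0:ℝ) := Ultrafilter.of_le _
  have hp : ∀ k, ∃ p ∈ K, Tendsto (c k) U (𝓝 p) := by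
    intro k
    obtain ⟨p, hp, h⟩ := hK.ultrafilter_le_nhds (U.map (c k))
      (le_principal_iff.2 (Filter.mem_map.2 (Filter.univ_mem' (hcK k))))
    exact ⟨p, hp, h⟩
  choose p hpK hp using hp
  obtain ⟨x, hx, hpx⟩ := hK.ultrafilter_le_nhds ((hyperfilter ℕ).map p)
      (le_principal_iff.2 (Filter.mem_map.2 (Filter.univ_mem' hpK)))
  refine ⟨x, fun L hLK hL hxL => ?_⟩
  have hZ : {k | p k ∉ L}.Infinite := by
    intro hfin
    have h1 : {k | p k ∉ L} ∈ (hyperfilter ℕ : Filter ℕ) :=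
      hpx (hL.isOpen_compl.mem_nhds hxL)
    exact notMem_hyperfilter_of_finite hfin h1
  intro N ε h0 h1
  obtain ⟨T, hTZ, hTN⟩ := hZ.exists_subset_card_eq N
  set n := T.sup id + 1 with hn
  have hTn : T ⊆ Finset.range n := fun k hk =>
    Finset.mem_range.2 (Nat.lt_succ_of_le (Finset.le_sup (f := id) hk))
  have hNn : N ≤ n := by
    have := Finset.card_le_card hTn
    simpa [hTN] using this
  have hf0 : Tendsto (f 0) U (𝓝 0) := (hf.2.2.2.1 0).mono_left hU
  have hfpos := (hf.1 n ε ⟨h0, h1⟩).1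
  have e1 : ∀ᶠ δ in (U : Filter ℝ), f 0 δ < f n ε := hf0.eventually_lt_const hfpos
  have e2 : ∀ᶠ δ in (U : Filter ℝ), 0 < δ ∧ δ < ε :=
    hU (Ioo_mem_nhdsGT h0)
  have e3 : ∀ᶠ δ in (U : Filter ℝ), ∀ k ∈ T, ∀ y ∈ L, y ∉ Set.Icc (a δ k) (b δ k) := by
    rw [Filter.eventually_all_finset]
    intro k hk
    have hkL : p k ∈ Lᶜ := hTZ hk
    obtain ⟨r, hr, hball⟩ := Metric.isOpen_iff.1 hL.isOpen_compl _ hkL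
    have e4 : ∀ᶠ δ in (U : Filter ℝ), c k δ ∈ Metric.ball (p k) (r / 2) :=
      (hp k) (Metric.ball_mem_nhds _ (by linarith))
    have e5 : ∀ᶠ δ in (U : Filter ℝ), f 0 δ < r / 2 := hf0.eventually_lt_const (by linarith)
    filter_upwards [e2, e4, e5] with δ h2 h4 h5 y hy hyI
    have hδ : δ ∈ Set.Ioo (0:ℝ) 1 := ⟨h2.1, by linarith⟩
    have hcI := hc k δ y (hLK hy) hyI
    have hlen := (hab δ hδ.1 hδ.2).2 k
    have hlen' := anti_f hf hδ (Nat.zero_le k)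
    refine hball ?_ hy
    rw [Metric.mem_ball, Real.dist_eq, abs_lt] at *
    constructor <;> linarith [hcI.1, hcI.2, hyI.1, hyI.2, h4.1, h4.2]
  obtain ⟨δ, h2, h3, h4⟩ := (e1.and (e2.and e3)).exists
  have hδ : δ ∈ Set.Ioo (0:ℝ) 1 := ⟨h3.1, by linarith [h3.2]⟩
  obtain ⟨hcov, hlen⟩ := hab δ hδ.1 hδ.2
  have hcard : (Finset.Ico N n).card = (Finset.range n \ T).card := by
    rw [Finset.card_sdiff_of_subset hTn]; simp [hTN]
  let h := Finset.equivOfCardEq hcard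
  let g : ℕ → ℕ := fun j => if hj : j ∈ Finset.Ico N n then (h ⟨j, hj⟩ : ℕ) else j
  refine ⟨fun j => a δ (g (N + j)), fun j => b δ (g (N + j)), fun y hy => ?_, fun j => ?_⟩
  · obtain ⟨k, hk⟩ := Set.mem_iUnion.1 (hcov (hLK hy))
    have hkT : k ∉ T := fun hkT => h4 k hkT y hy hk
    have : ∃ j, N ≤ j ∧ g j = k := by
      by_cases hkn : k < n
      · have hk' : k ∈ Finset.range n \ T := by simp [hkn, hkT]
        refine ⟨(h.symm ⟨k, hk'⟩ : ℕ), (Finset.mem_Ico.1 (h.symm ⟨k, hk'⟩).2).1, ?_⟩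
        have hm := (h.symm ⟨k, hk'⟩).2
        simp only [g]
        rw [dif_pos hm]
        simp
      · refine ⟨k, by omega, ?_⟩
        simp only [g]
        rw [dif_neg (by simp; omega)]
    obtain ⟨j, hj, hjk⟩ := this
    refine Set.mem_iUnion.2 ⟨j - N, ?_⟩
    have : N + (j - N) = j := by omega
    simp only [this, hjk]
    exact hk
  · refine (hlen _).trans ?_
    by_cases hj : N + j < n
    · exact ((anti_f hf hδ (Nat.zero_le _)).trans h2.le).trans (anti_f hf ⟨h0, h1⟩ hj.le)
    · have : g (N + j) = N + j := by
        simp only [g]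
        rw [dif_neg (by simp; omega)]
      rw [this]
      exact (hf.2.1 (N + j) hδ ⟨h0, h1⟩ h3.2).le

lemma tail_empty {f : ℕ → ℝ → ℝ} (hf : StandardConditions f) : TailMic f ∅ := by
  intro N ε h0 h1
  exact ⟨fun _ => 0, fun _ => 0, Set.empty_subset _, fun k => by
    simpa using (hf.1 (N + k) ε ⟨h0, h1⟩).1.le⟩

lemma mic_mono {f : ℕ → ℝ → ℝ} {A B : Set ℝ} (h : A ⊆ B) (hB : FnMicroscopic f B) :
    FnMicroscopic f A := by
  intro ε h0 h1
  obtain ⟨a, b, hc, hl⟩ := hB ε h0 h1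
  exact ⟨a, b, h.trans hc, hl⟩

lemma compact_decomp {f : ℕ → ℝ → ℝ} (hf : StandardConditions f) {K : Set ℝ} (hK : IsCompact K)
    (hm : FnMicroscopic f K) :
    ∃ L : ℕ → Set ℝ, (∀ i, IsCompact (L i)) ∧ (∀ i, TailMic f (L i)) ∧ K ⊆ ⋃ i, L i := by
  rcases K.eq_empty_or_nonempty with rfl | hne
  · exact ⟨fun _ => ∅, fun _ => isCompact_empty, fun _ => tail_empty hf, Set.empty_subset _⟩
  obtain ⟨x, hx⟩ := exists_bad hf hK hne hm
  let C : ℕ → Set ℝ := fun i => K ∩ {y | 1 / ((i : ℝ) + 1) ≤ |y - x|}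
  have hCc : ∀ i, IsClosed {y : ℝ | 1 / ((i : ℝ) + 1) ≤ |y - x|} := fun i =>
    isClosed_le continuous_const (by fun_prop)
  refine ⟨fun i => Nat.casesOn i {x} C, fun i => ?_, fun i => ?_, fun y hy => ?_⟩
  · cases i with
    | zero => exact isCompact_singleton
    | succ i => exact hK.inter_right (hCc i)
  · cases i with
    | zero => exact tail_singleton hf x
    | succ i =>
      refine hx (C i) Set.inter_subset_left (hK.inter_right (hCc i)).isClosed ?_
      rintro ⟨-, h⟩
      simp only [Set.mem_setOf_eq, sub_self, abs_zero] at h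
      have : 0 < 1 / ((i : ℝ) + 1) := by positivity
      linarith
  · by_cases hyx : y = x
    · exact Set.mem_iUnion.2 ⟨0, hyx⟩
    · obtain ⟨i, hi⟩ := exists_nat_one_div_lt (abs_pos.2 (sub_ne_zero.2 hyx))
      exact Set.mem_iUnion.2 ⟨i + 1, hy, hi.le⟩

theorem stmt7 (f : ℕ → ℝ → ℝ) (hf : StandardConditions f) :
    MicroStar f ∅ ∧
    (∀ A B : Set ℝ, A ⊆ B → MicroStar f B → MicroStar f A) ∧
    (∀ A : ℕ → Set ℝ, (∀ n, MicroStar f (A n)) → MicroStar f (⋃ n, A n)) := by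
  refine ⟨⟨∅, ⟨fun _ => ∅, fun _ => isClosed_empty, by simp⟩, ?_, Set.Subset.rfl⟩, ?_, ?_⟩
  · intro ε h0 h1
    simpa using tail_empty hf 0 ε h0 h1
  · rintro A B hAB ⟨F, h1, h2, h3⟩
    exact ⟨F, h1, h2, hAB.trans h3⟩
  · intro A hA
    choose F hF hm hAF using hA
    choose C hC hFC using hF
    have hd : ∀ n m r : ℕ, ∃ L : ℕ → Set ℝ, (∀ i, IsCompact (L i)) ∧ (∀ i, TailMic f (L i)) ∧
        C n m ∩ Set.Icc (-(r:ℝ)) r ⊆ ⋃ i, L i := by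
      intro n m r
      refine compact_decomp hf (isCompact_Icc.inter_left (hC n m)) (mic_mono ?_ (hm n))
      rw [hFC n]
      exact Set.inter_subset_left.trans (Set.subset_iUnion (C n) m)
    choose L hLc hLT hL using hd
    obtain ⟨e, he⟩ := exists_surjective_nat (ℕ × ℕ × ℕ × ℕ)
    let G : ℕ → Set ℝ := fun i => L (e i).1 (e i).2.1 (e i).2.2.1 (e i).2.2.2
    refine ⟨⋃ i, G i, ⟨G, fun i => (hLc _ _ _ _).isClosed, rfl⟩,
      union_mic hf G (fun i => hLc _ _ _ _) (fun i => hLT _ _ _ _), fun y hy => ?_⟩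
    obtain ⟨n, hn⟩ := Set.mem_iUnion.1 hy
    have h1 := hAF n hn
    rw [hFC n] at h1
    obtain ⟨m, hm'⟩ := Set.mem_iUnion.1 h1
    obtain ⟨r, hr⟩ := exists_nat_ge |y|
    obtain ⟨i, hi⟩ := Set.mem_iUnion.1 (hL n m r ⟨hm', abs_le.1 hr⟩)
    obtain ⟨j, hj⟩ := he (n, m, r, i)
    refine Set.mem_iUnion.2 ⟨j, ?_⟩
    simp only [G, hj]
    exact hi
end

section
/- Let (f_n) satisfy the standard conditions. If A ⊆ ℝ can be covered by an (f_n)-microscopic F_σ set, and B ⊆ ℝ has strong measure zero, then A ∪ B is (f_n)-microscopic. -/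
open Set MeasureTheory

/-- `L` can be covered by finitely many intervals with indices beyond any bound. -/
def InfGood (f : ℕ → ℝ → ℝ) (L : Set ℝ) : Prop :=
  ∀ ε : ℝ, 0 < ε → ε < 1 → ∀ N : ℕ, ∃ M : ℕ, ∃ a b : ℕ → ℝ,
    (∀ x ∈ L, ∃ k, N ≤ k ∧ k < M ∧ x ∈ Set.Icc (a k) (b k)) ∧
    ∀ k, N ≤ k → b k - a k ≤ f k ε

lemma infGood_of_compact (f : ℕ → ℝ → ℝ) (hf : StandardConditions f) (L : Set ℝ)
    (hL : IsCompact L)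
    (h : ∀ ε : ℝ, 0 < ε → ε < 1 → ∀ N : ℕ, ∃ a b : ℕ → ℝ,
      (∀ x ∈ L, ∃ k, N ≤ k ∧ x ∈ Set.Icc (a k) (b k)) ∧
      ∀ k, N ≤ k → b k - a k ≤ f k ε) : InfGood f L := by
  intro ε h0 h1 N
  obtain ⟨a, b, hc, hl⟩ := h (ε / 2) (by linarith) (by linarith) N
  have hη : ∀ k, 0 < (f k ε - f k (ε / 2)) / 2 := by
    intro k
    have := hf.2.1 k (show ε / 2 ∈ Set.Ioo (0:ℝ) 1 from ⟨by linarith, by linarith⟩)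
      (show ε ∈ Set.Ioo (0:ℝ) 1 from ⟨h0, h1⟩) (by linarith)
    linarith
  set η : ℕ → ℝ := fun k => (f k ε - f k (ε / 2)) / 2 with hηd
  obtain ⟨t, ht⟩ := hL.elim_finite_subcover
    (fun k : {k : ℕ // N ≤ k} => Set.Ioo (a k - η k) (b k + η k)) (fun _ => isOpen_Ioo) (by
      intro x hx
      obtain ⟨k, hk, hx1, hx2⟩ := hc x hx
      refine Set.mem_iUnion.2 ⟨⟨k, hk⟩, ?_, ?_⟩
      · have := hη k
        simp only [hηd]; linarith
      · have := hη k
        simp only [hηd]; linarith)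
  refine ⟨t.sup (fun k => (k : ℕ)) + 1, fun k => a k - η k, fun k => b k + η k, ?_, ?_⟩
  · intro x hx
    obtain ⟨k, hk, hxk⟩ := Set.mem_iUnion₂.1 (ht hx)
    refine ⟨k, k.2, ?_, hxk.1.le, hxk.2.le⟩
    have : (k : ℕ) ≤ t.sup (fun k => (k : ℕ)) := Finset.le_sup (f := fun k : {k : ℕ // N ≤ k} => (k : ℕ)) hk
    omega
  · intro k hk
    have := hl k hk
    simp only [hηd]; linarith

lemma clamp_close (R a x : ℝ) (h1 : -R ≤ x) (h2 : x ≤ R) :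
    |max (-R) (min R a) - x| ≤ |a - x| := by
  rcases le_total R a with h | h
  · rw [min_eq_left h, max_eq_right (by linarith), abs_of_nonneg (by linarith),
      abs_of_nonneg (by linarith)]
    linarith
  · rw [min_eq_right h]
    rcases le_total (-R) a with h' | h'
    · rw [max_eq_right h']
    · rw [max_eq_left h', abs_of_nonpos (by linarith), abs_of_nonpos (by linarith)]
      linarith

lemma f_anti (f : ℕ → ℝ → ℝ) (hf : StandardConditions f) (x : ℝ) (hx : x ∈ Set.Ioo (0:ℝ) 1) :
    Antitone (fun n => f n x) :=
  antitone_nat_of_succ_le (fun n => hf.2.2.1 n x hx)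

lemma exists_point (f : ℕ → ℝ → ℝ) (hf : StandardConditions f) (K : Set ℝ) (R : ℝ) (hR : 0 ≤ R)
    (hK : K ⊆ Set.Icc (-R) R) (hm : FnMicroscopic f K) :
    ∃ q : ℝ, ∀ r : ℝ, 0 < r → ∀ ε : ℝ, 0 < ε → ε < 1 → ∀ N : ℕ, ∃ a b : ℕ → ℝ,
      (∀ x ∈ K \ Metric.ball q r, ∃ k, N ≤ k ∧ x ∈ Set.Icc (a k) (b k)) ∧
      ∀ k, N ≤ k → b k - a k ≤ f k ε := by
  have hδ0 : ∀ j : ℕ, 0 < 1 / ((j : ℝ) + 2) := fun j => by positivity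
  have hδ1 : ∀ j : ℕ, 1 / ((j : ℝ) + 2) < 1 := fun j => by
    rw [div_lt_one (by positivity)]
    have : (0:ℝ) ≤ j := Nat.cast_nonneg j
    linarith
  set δ : ℕ → ℝ := fun j => 1 / ((j : ℝ) + 2) with hδd
  have hδt : Filter.Tendsto δ Filter.atTop (nhdsWithin 0 (Set.Ioi 0)) := by
    refine tendsto_nhdsWithin_iff.2 ⟨?_, Filter.Eventually.of_forall hδ0⟩
    have := (tendsto_const_div_atTop_nhds_zero_nat (1:ℝ)).comp (Filter.tendsto_add_atTop_nat 2)
    refine this.congr (fun j => ?_)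
    simp [hδd]
  have hcov : ∀ j, IntervalCover K (fun k => f k (δ j)) := fun j => hm _ (hδ0 j) (hδ1 j)
  choose a b hab hlen using hcov
  set U : Ultrafilter ℕ := Filter.hyperfilter ℕ with hU
  have hUt : (U : Filter ℕ) ≤ Filter.atTop := by
    rw [hU, ← Nat.cofinite_eq_atTop]; exact Filter.hyperfilter_le_cofinite
  set c : ℕ → ℕ → ℝ := fun j k => max (-R) (min R (a j k)) with hc
  have hcm : ∀ j k, c j k ∈ Set.Icc (-R) R := fun j k =>
    ⟨le_max_left _ _, max_le (by linarith) (min_le_left _ _)⟩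
  have key : ∀ g : ℕ → ℝ, (∀ j, g j ∈ Set.Icc (-R) R) →
      ∃ p ∈ Set.Icc (-R) R, Filter.Tendsto g U (nhds p) := by
    intro g hg
    obtain ⟨p, hp, hp'⟩ := (isCompact_Icc (a := -R) (b := R)).ultrafilter_le_nhds (U.map g) (by
      rw [Filter.le_principal_iff]
      exact Filter.mem_map.2 (Filter.univ_mem' hg))
    exact ⟨p, hp, hp'⟩
  choose p hpm hp using fun k => key (fun j => c j k) (fun j => hcm j k)
  obtain ⟨q, hqm, hq⟩ := key p hpm
  refine ⟨q, fun r hr ε h0 h1 N => ?_⟩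
  have hS : {k | dist (p k) q < r / 3} ∈ (U : Filter ℕ) := hq (Metric.ball_mem_nhds q (by linarith))
  have hS' : {k | dist (p k) q < r / 3 ∧ N ≤ k} ∈ (U : Filter ℕ) :=
    Filter.inter_mem hS (hUt (Filter.eventually_ge_atTop N))
  have hinf : {k | dist (p k) q < r / 3 ∧ N ≤ k}.Infinite := by
    intro hfin
    exact Filter.notMem_hyperfilter_of_finite hfin hS'
  set t := hinf.natEmbedding with ht
  have e1 : ∀ᶠ j in (U : Filter ℕ), ∀ i ∈ Finset.range N, dist (c j (t i)) (p (t i)) < r / 3 := by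
    rw [Filter.eventually_all_finset]
    intro i _
    exact hp (t i) (Metric.ball_mem_nhds _ (by linarith))
  have hf0 : Filter.Tendsto (fun j => f 0 (δ j)) U (nhds 0) :=
    ((hf.2.2.2.1 0).comp hδt).mono_left hUt
  have e2 : ∀ᶠ j in (U : Filter ℕ), ∀ i ∈ Finset.range N, f 0 (δ j) < f (t i) ε := by
    rw [Filter.eventually_all_finset]
    intro i _
    exact hf0.eventually_lt_const (hf.1 _ ε ⟨h0, h1⟩).1
  have e3 : ∀ᶠ j in (U : Filter ℕ), f 0 (δ j) < r / 3 := hf0.eventually_lt_const (by linarith)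
  have e4 : ∀ᶠ j in (U : Filter ℕ), δ j < ε :=
    ((tendsto_nhdsWithin_iff.1 hδt).1.mono_left hUt).eventually_lt_const h0
  obtain ⟨j, j1, j2, j3, j4⟩ := (e1.and (e2.and (e3.and e4))).exists
  have hanti := f_anti f hf (δ j) ⟨hδ0 j, hδ1 j⟩
  classical
  -- the reindexing
  let σ : ℕ → ℕ := fun k => if h : ∃ i, i < N ∧ (t i : ℕ) = k then h.choose else k
  have hσt : ∀ i, i < N → σ (t i) = i := by
    intro i hi
    have h : ∃ i', i' < N ∧ (t i' : ℕ) = (t i : ℕ) := ⟨i, hi, rfl⟩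
    simp only [σ, dif_pos h]
    exact t.injective (Subtype.ext h.choose_spec.2)
  have hσn : ∀ k, (¬ ∃ i, i < N ∧ (t i : ℕ) = k) → σ k = k := by
    intro k h
    simp only [σ, dif_neg h]
  refine ⟨fun k => a j (σ k), fun k => b j (σ k), ?_, ?_⟩
  · rintro x ⟨hxK, hxq⟩
    obtain ⟨k, hk⟩ := Set.mem_iUnion.1 (hab j hxK)
    by_cases hkN : k < N
    · refine ⟨t k, (t k).2.2, ?_⟩
      simpa only [hσt k hkN] using hk
    · by_cases h : ∃ i, i < N ∧ (t i : ℕ) = k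
      · exfalso
        obtain ⟨i, hi, rfl⟩ := h
        apply hxq
        have d1 := j1 i (Finset.mem_range.2 hi)
        have d2 : dist (p (t i)) q < r / 3 := (t i).2.1
        have d3 : |c j (t i) - x| ≤ |a j (t i) - x| :=
          clamp_close R _ x (hK hxK).1 (hK hxK).2
        have d4 : |a j (t i) - x| ≤ f 0 (δ j) := by
          rw [abs_of_nonpos (by linarith [hk.1])]
          have := hlen j (t i)
          have := hanti (Nat.zero_le (t i : ℕ))
          simp only at *
          linarith [hk.2]
        rw [Metric.mem_ball]
        have d5 : dist x (c j (t i)) < r / 3 := by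
          rw [dist_comm, Real.dist_eq]; linarith
        have := dist_triangle4 x (c j (t i)) (p (t i)) q
        linarith
      · refine ⟨k, not_lt.1 hkN, ?_⟩
        simpa only [hσn k h] using hk
  · intro k hk
    by_cases h : ∃ i, i < N ∧ (t i : ℕ) = k
    · obtain ⟨i, hi, rfl⟩ := h
      have h1 := j2 i (Finset.mem_range.2 hi)
      have h2 := hlen j i
      have h3 := hanti (Nat.zero_le i)
      simp only [hσt i hi] at *
      linarith
    · have h2 := hlen j k
      have h3 := hf.2.1 k ⟨hδ0 j, hδ1 j⟩ ⟨h0, h1⟩ j4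
      simp only [hσn k h] at *
      linarith

lemma infGood_singleton (f : ℕ → ℝ → ℝ) (hf : StandardConditions f) (q : ℝ) :
    InfGood f {q} := by
  intro ε h0 h1 N
  refine ⟨N + 1, fun _ => q, fun _ => q, ?_, ?_⟩
  · intro x hx
    exact ⟨N, le_rfl, by omega, by rw [Set.mem_singleton_iff.1 hx]; simp⟩
  · intro k _
    simpa using (hf.1 k ε ⟨h0, h1⟩).1.le

lemma sigma_good (f : ℕ → ℝ → ℝ) (hf : StandardConditions f) (F : Set ℝ)
    (hF : IsFsigma F) (hm : FnMicroscopic f F) :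
    ∃ L : ℕ → Set ℝ, (∀ n, InfGood f (L n)) ∧ F ⊆ ⋃ n, L n := by
  obtain ⟨C, hC, rfl⟩ := hF
  let K : ℕ × ℕ → Set ℝ := fun z => C z.1 ∩ Set.Icc (-(z.2 : ℝ)) z.2
  have hKc : ∀ z, IsCompact (K z) := fun z => isCompact_Icc.inter_left (hC z.1)
  have hKm : ∀ z, FnMicroscopic f (K z) := by
    intro z ε h0 h1
    obtain ⟨a, b, hab, hl⟩ := hm ε h0 h1
    exact ⟨a, b, fun x hx => hab (Set.mem_iUnion.2 ⟨z.1, hx.1⟩), hl⟩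
  choose q hq using fun z => exists_point f hf (K z) z.2 (Nat.cast_nonneg _)
    (fun x hx => hx.2) (hKm z)
  let L : (ℕ × ℕ) × Option ℕ → Set ℝ := fun w =>
    match w.2 with
    | none => {q w.1}
    | some i => K w.1 \ Metric.ball (q w.1) (1 / ((i : ℝ) + 1))
  have hL : ∀ w, InfGood f (L w) := by
    rintro ⟨z, _ | i⟩
    · exact infGood_singleton f hf _
    · exact infGood_of_compact f hf _ ((hKc z).diff Metric.isOpen_ball)
        (hq z _ (by positivity))
  obtain ⟨e, he⟩ := exists_surjective_nat ((ℕ × ℕ) × Option ℕ)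
  refine ⟨fun n => L (e n), fun n => hL _, ?_⟩
  intro x hx
  obtain ⟨n, hn⟩ := Set.mem_iUnion.1 hx
  obtain ⟨m, hm⟩ := exists_nat_ge |x|
  have hxK : x ∈ K (n, m) := ⟨hn, abs_le.1 hm⟩
  have : ∃ w, x ∈ L w := by
    by_cases hxq : x = q (n, m)
    · exact ⟨((n, m), none), hxq⟩
    · obtain ⟨i, hi⟩ := exists_nat_one_div_lt (dist_pos.2 hxq)
      refine ⟨((n, m), some i), hxK, ?_⟩
      rw [Metric.mem_ball]
      exact not_lt.2 hi.le
  obtain ⟨w, hw⟩ := this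
  obtain ⟨k, rfl⟩ := he w
  exact Set.mem_iUnion.2 ⟨k, hw⟩

lemma cover_of_embedding (M : Set ℝ) (len : ℕ → ℝ) (h0 : ∀ k, 0 ≤ len k) {ι : Type} (e : ι → ℕ)
    (he : Function.Injective e) (a b : ι → ℝ) (hM : ∀ x ∈ M, ∃ i, x ∈ Set.Icc (a i) (b i))
    (hl : ∀ i, b i - a i ≤ len (e i)) : IntervalCover M len := by
  refine ⟨Function.extend e a 0, Function.extend e b 0, ?_, ?_⟩
  · intro x hx
    obtain ⟨i, hi⟩ := hM x hx
    refine Set.mem_iUnion.2 ⟨e i, ?_⟩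
    rwa [he.extend_apply, he.extend_apply]
  · intro k
    by_cases h : ∃ i, e i = k
    · obtain ⟨i, rfl⟩ := h
      rw [he.extend_apply, he.extend_apply]
      exact hl i
    · rw [Function.extend_apply' _ _ _ h, Function.extend_apply' _ _ _ h]
      simpa using h0 k

theorem stmt9 (f : ℕ → ℝ → ℝ) (hf : StandardConditions f)
    (A B : Set ℝ) (hA : MicroStar f A) (hB : StrongMeasureZero B) :
    FnMicroscopic f (A ∪ B) := by
  obtain ⟨F, hF, hm, hAF⟩ := hA
  obtain ⟨L, hL, hFL⟩ := sigma_good f hf F hF hm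
  intro ε h0 h1
  have hpos : ∀ k, 0 < f k ε := fun k => (hf.1 k ε ⟨h0, h1⟩).1
  choose M a b hc hl using fun s N => hL s ε h0 h1 N
  obtain ⟨n, hn⟩ : ∃ n : ℕ → ℕ, ∀ s, n (s + 1) = max (n s + 1) (M s (n s + 1)) :=
    ⟨fun s => Nat.rec (motive := fun _ => ℕ) 0 (fun s N => max (N + 1) (M s (N + 1))) s,
      fun s => rfl⟩
  classical
  have hmono : StrictMono n := strictMono_nat_of_lt_succ (fun s => by
    rw [hn]; exact lt_of_lt_of_le (Nat.lt_succ_self _) (le_max_left _ _))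
  obtain ⟨a', b', hB', hl'⟩ := hB (fun s => f (n s) ε) (fun s => hpos _)
  refine cover_of_embedding _ _ (fun k => (hpos k).le)
    (ι := {z : ℕ × ℕ // n z.1 ≤ z.2 ∧ z.2 < n (z.1 + 1)}) (fun z => z.1.2) ?_
    (fun z : {z : ℕ × ℕ // n z.1 ≤ z.2 ∧ z.2 < n (z.1 + 1)} => if z.1.2 = n z.1.1 then a' z.1.1 else a z.1.1 (n z.1.1 + 1) z.1.2)
    (fun z : {z : ℕ × ℕ // n z.1 ≤ z.2 ∧ z.2 < n (z.1 + 1)} => if z.1.2 = n z.1.1 then b' z.1.1 else b z.1.1 (n z.1.1 + 1) z.1.2) ?_ ?_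
  · rintro ⟨⟨s, k⟩, h1, h2⟩ ⟨⟨s', k'⟩, h1', h2'⟩ h
    simp only at h h1 h2 h1' h2'
    subst h
    have i1 := hmono.lt_iff_lt.1 (h1.trans_lt h2')
    have i2 := hmono.lt_iff_lt.1 (h1'.trans_lt h2)
    have : s = s' := by omega
    subst this
    rfl
  · rintro x (hx | hx)
    · obtain ⟨s, hs⟩ := Set.mem_iUnion.1 (hFL (hAF hx))
      obtain ⟨k, hk1, hk2, hk3⟩ := hc s (n s + 1) x hs
      refine ⟨⟨(s, k), by simp only; omega, ?_⟩, ?_⟩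
      · simp only [hn]; exact lt_of_lt_of_le hk2 (le_max_right _ _)
      · have : k ≠ n s := by omega
        simpa only [if_neg this] using hk3
    · obtain ⟨s, hs⟩ := Set.mem_iUnion.1 (hB' hx)
      refine ⟨⟨(s, n s), le_rfl, hmono (Nat.lt_succ_self s)⟩, ?_⟩
      simpa using hs
  · rintro ⟨⟨s, k⟩, h1, h2⟩
    simp only at h1 h2 ⊢
    by_cases h : k = n s
    · subst h
      simpa using hl' s
    · simp only [if_neg h]
      exact hl s _ k (by omega)
end

section
/- Let (f_n) satisfy the standard conditions, let X ⊆ ℝ be a bounded (f_n)-microscopic set, and let Y ⊆ ℝ have strong measure zero. Then X ∪ Y is (f_n)-microscopic. -/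
open Set MeasureTheory

theorem stmt11 (f : ℕ → ℝ → ℝ) (hf : StandardConditions f)
    (X Y : Set ℝ) (hXb : Bornology.IsBounded X) (hX : FnMicroscopic f X)
    (hY : StrongMeasureZero Y) :
    FnMicroscopic f (X ∪ Y) := by
  obtain ⟨h1, h2, h3, h4, x₀, hx₀, h5⟩ := hf
  intro ε hε0 hε1
  have hεI : ε ∈ Set.Ioo (0:ℝ) 1 := ⟨hε0, hε1⟩
  have hanti : ∀ x ∈ Set.Ioo (0:ℝ) 1, Antitone (fun n => f n x) :=
    fun x hx => antitone_nat_of_succ_le (fun n => h3 n x hx)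
  obtain ⟨L, hL⟩ := hXb.subset_closedBall (0:ℝ)
  set R : ℝ := |L| + 1 with hR
  have hRpos : 0 < R := by positivity
  obtain ⟨η, hη⟩ : ∃ η, η = f 0 ε / 2 := ⟨_, rfl⟩
  have hηpos : 0 < η := by have := (h1 0 ε hεI).1; linarith
  obtain ⟨N, hN⟩ : ∃ N, N = (Finset.Icc ⌊-R/η⌋ ⌊R/η⌋).card := ⟨_, rfl⟩
  have hfN := (h1 N ε hεI).1
  obtain ⟨e, he0, he1, hex, hee, heη, heN⟩ : ∃ e : ℝ, 0 < e ∧ e < 1 ∧ e < x₀ ∧ e < ε ∧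
      f 0 e < η ∧ f 0 e < f N ε := by
    have A : ∀ᶠ e in nhdsWithin (0:ℝ) (Set.Ioi 0), f 0 e < η := (h4 0).eventually_lt_const hηpos
    have B : ∀ᶠ e in nhdsWithin (0:ℝ) (Set.Ioi 0), f 0 e < f N ε := (h4 0).eventually_lt_const hfN
    have C : ∀ᶠ e in nhdsWithin (0:ℝ) (Set.Ioi 0), e ∈ Set.Ioo 0 (min x₀ ε) :=
      Ioo_mem_nhdsGT (lt_min hx₀ hε0)
    obtain ⟨e, ha, hb, hc⟩ := (A.and (B.and C)).exists
    exact ⟨e, hc.1, by have := hc.2.trans_le (min_le_right _ _); linarith,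
      hc.2.trans_le (min_le_left _ _), hc.2.trans_le (min_le_right _ _), ha, hb⟩
  have heI : e ∈ Set.Ioo (0:ℝ) 1 := ⟨he0, he1⟩
  obtain ⟨a, ha, hcov⟩ : ∃ a : ℕ → ℝ, (∀ k, a k ∈ Set.Icc (-R) R) ∧
      ∀ x ∈ X, ∃ k, a k ≤ x ∧ x ≤ a k + f k e := by
    obtain ⟨a, b, hab, hlen⟩ := hX e he0 he1
    refine ⟨fun k => if a k ∈ Set.Icc (-R) R then a k else 0, fun k => ?_, fun x hx => ?_⟩
    · dsimp only
      split_ifs with h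
      · exact h
      · constructor <;> linarith
    · obtain ⟨k, hk⟩ := Set.mem_iUnion.1 (hab hx)
      have h6 := hL hx
      rw [Metric.mem_closedBall, dist_zero_right, Real.norm_eq_abs] at h6
      have h7 := abs_le.1 (h6.trans (le_abs_self L))
      have h8 := hlen k
      have h9 := (h1 k e heI).2
      have h10 := hk.1
      have h11 := hk.2
      dsimp only at h8
      refine ⟨k, ?_⟩
      dsimp only
      rw [if_pos (show a k ∈ Set.Icc (-R) R from ⟨by linarith, by linarith⟩)]
      constructor <;> linarith
  obtain ⟨i, j, hij, hjN, hd⟩ : ∃ i j : ℕ, i < j ∧ j ≤ N ∧ |a i - a j| < η := by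
    have : ∃ x ∈ Finset.range (N+1), ∃ y ∈ Finset.range (N+1), x ≠ y ∧ ⌊a x / η⌋ = ⌊a y / η⌋ := by
      apply Finset.exists_ne_map_eq_of_card_lt_of_maps_to (t := Finset.Icc ⌊-R/η⌋ ⌊R/η⌋)
      · rw [← hN]; simp
      · intro k _
        have h6 := ha k
        simp only [Finset.coe_Icc, Set.mem_Icc]
        exact ⟨Int.floor_le_floor (by gcongr; exact h6.1), Int.floor_le_floor (by gcongr; exact h6.2)⟩
    obtain ⟨x, hx, y, hy, hxy, hfl⟩ := this
    have h6 := Int.abs_sub_lt_one_of_floor_eq_floor hfl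
    rw [← sub_div, abs_div, abs_of_pos hηpos, div_lt_one hηpos] at h6
    rw [Finset.mem_range] at hx hy
    rcases lt_or_gt_of_ne hxy with h | h
    · exact ⟨x, y, h, by omega, h6⟩
    · exact ⟨y, x, h, by omega, by rwa [abs_sub_comm]⟩
  obtain ⟨p, -, φ, hφ, hlim⟩ := isCompact_Icc.tendsto_subseq ha
  have hfj := (h1 j ε hεI).1
  have hz : Filter.Tendsto (fun n => f (φ n) e) Filter.atTop (nhds 0) :=
    (h5 e he0 hex).tendsto_atTop_zero.comp hφ.tendsto_atTop
  obtain ⟨ψ, hψ, hψj, hψS⟩ : ∃ ψ : ℕ → ℕ, Function.Injective ψ ∧ (∀ n, j < ψ n) ∧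
      ∀ n, p - f j ε / 2 ≤ a (ψ n) ∧ a (ψ n) + f (ψ n) e ≤ p - f j ε / 2 + f j ε := by
    have A := hlim.eventually (Ioo_mem_nhds (show p - f j ε / 4 < p by linarith)
      (show p < p + f j ε / 4 by linarith))
    have B := hz.eventually_lt_const (show 0 < f j ε / 4 by linarith)
    obtain ⟨n0, hn0⟩ := Filter.eventually_atTop.1 (A.and B)
    refine ⟨fun n => φ (n + (n0 + j + 1)), fun x y h => ?_, fun n => ?_, fun n => ?_⟩
    · have := hφ.injective h; omega
    · have := hφ.le_apply (x := n + (n0 + j + 1)); dsimp only; omega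
    · obtain ⟨h6, h7⟩ := hn0 (n + (n0 + j + 1)) (by omega)
      have h8 := h6.1
      have h9 := h6.2
      dsimp only [Function.comp] at h8 h9 ⊢
      constructor <;> linarith
  obtain ⟨y, y', hy, hylen⟩ := hY (fun n => f (ψ n) ε) (fun n => (h1 _ ε hεI).1)
  obtain ⟨c, hc⟩ : ∃ c : ℕ → ℝ, c = fun k => if k = 0 then min (a i) (a j) else
    if k = j then p - f j ε / 2 else if k = i then a 0 else Function.extend ψ y a k := ⟨_, rfl⟩
  refine ⟨c, fun k => c k + f k ε, ?_, fun k => by simp⟩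
  have hc0 : c 0 = min (a i) (a j) := by simp [hc]
  have hcj : c j = p - f j ε / 2 := by
    have : j ≠ 0 := by omega
    simp [hc, this]
  have hci : i ≠ 0 → c i = a 0 := by
    intro h
    have : i ≠ j := by omega
    simp [hc, h, this]
  have hcψ : ∀ n, c (ψ n) = y n := by
    intro n
    have := hψj n
    rw [hc]
    dsimp only
    rw [if_neg (by omega), if_neg (by omega), if_neg (by omega), hψ.extend_apply]
  have hce : ∀ k, k ≠ 0 → k ≠ j → k ≠ i → (¬ ∃ n, ψ n = k) → c k = a k := by
    intro k h h' h'' h'''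
    rw [hc]
    dsimp only
    rw [if_neg h, if_neg h', if_neg h'', Function.extend_apply' _ _ _ h''']
  have hd' := abs_lt.1 hd
  have key : ∀ k, (k = i ∨ k = j) → min (a i) (a j) ≤ a k ∧
      a k + f k e ≤ min (a i) (a j) + f 0 ε := by
    intro k hk
    have h6 : f k e ≤ f 0 e := hanti e heI (Nat.zero_le k)
    rcases hk with rfl | rfl
    · refine ⟨min_le_left _ _, ?_⟩
      rcases min_choice (a k) (a j) with h | h <;> rw [h] <;> linarith
    · refine ⟨min_le_right _ _, ?_⟩
      rcases min_choice (a i) (a k) with h | h <;> rw [h] <;> linarith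
  rintro x (hx | hx)
  · obtain ⟨k, hk1, hk2⟩ := hcov x hx
    rw [Set.mem_iUnion]
    simp only [Set.mem_Icc]
    by_cases hkij : k = i ∨ k = j
    · have := key k hkij
      refine ⟨0, ?_⟩
      rw [hc0]
      constructor <;> linarith
    push Not at hkij
    by_cases hk0 : k = 0
    · subst hk0
      refine ⟨i, ?_⟩
      rw [hci hkij.1.symm]
      have : f N ε ≤ f i ε := hanti ε hεI (by omega)
      constructor <;> linarith
    by_cases hkψ : ∃ n, ψ n = k
    · obtain ⟨n, rfl⟩ := hkψ
      have := hψS n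
      refine ⟨j, ?_⟩
      rw [hcj]
      constructor <;> linarith
    · refine ⟨k, ?_⟩
      rw [hce k hk0 hkij.2 hkij.1 hkψ]
      have := h2 k heI hεI hee
      constructor <;> linarith
  · obtain ⟨n, hn⟩ := Set.mem_iUnion.1 (hy hx)
    rw [Set.mem_iUnion]
    refine ⟨ψ n, ?_⟩
    have h6 := hylen n
    have h7 := hn.1
    have h8 := hn.2
    dsimp only at h6
    rw [Set.mem_Icc]
    dsimp only
    rw [hcψ]
    constructor <;> linarith
end

section
/- The family of nanoscopic subsets of ℝ is not an ideal: there exist nanoscopic sets A, B ⊆ ℝ such that A ∪ B is not nanoscopic. -/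
open Set MeasureTheory

noncomputable def dl (k : ℕ) : ℝ := (1/2 : ℝ) ^ (2 ^ k)

lemma dl_pos (k : ℕ) : 0 < dl k := by unfold dl; positivity

lemma dl_anti {j k : ℕ} (h : j ≤ k) : dl k ≤ dl j := by
  unfold dl
  exact pow_le_pow_of_le_one (by norm_num) (by norm_num) (Nat.pow_le_pow_right (by norm_num) h)

def Meets (u v a b : ℝ) : Prop := (Icc u v ∩ Icc a b).Nonempty

lemma card_bound (S : Finset ℕ) (Y : ℝ) (hY : 0 ≤ Y)
    (h : ∀ c ∈ S, ∀ c' ∈ S, (c : ℝ) - c' ≤ Y) : (S.card : ℝ) ≤ Y + 1 := by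
  rcases S.eq_empty_or_nonempty with rfl | hS
  · simp; linarith
  · have h1 : S ⊆ Finset.Icc (S.min' hS) (S.max' hS) := fun c hc =>
      Finset.mem_Icc.2 ⟨S.min'_le c hc, S.le_max' c hc⟩
    have h2 := Finset.card_le_card h1
    rw [Nat.card_Icc] at h2
    have h3 := h _ (S.max'_mem hS) _ (S.min'_mem hS)
    have h4 : S.min' hS ≤ S.max' hS := S.min'_le _ (S.max'_mem hS)
    have h5 : S.card + S.min' hS ≤ S.max' hS + 1 := by omega
    have h6 : (S.card : ℝ) + (S.min' hS : ℕ) ≤ (S.max' hS : ℕ) + 1 := by exact_mod_cast h5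
    linarith

lemma geo (s : ℕ) : ∑ j ∈ Finset.range s, (1/8 : ℝ) ^ (j+1) ≤ 1/7 := by
  have : ∑ j ∈ Finset.range s, (1/8 : ℝ) ^ (j+1) = (1 - (1/8)^s)/7 := by
    induction s with
    | zero => simp
    | succ n ih => rw [Finset.sum_range_succ, ih]; ring
  rw [this]
  have : (0:ℝ) < (1/8)^s := by positivity
  linarith

lemma elen {j k : ℕ} (h : k < j) : (1/16 : ℝ) ^ (2 ^ j) ≤ (1/8) ^ (j+1) * dl k := by
  have h1 : (1/16 : ℝ) ^ (2 ^ j) = (1/8) ^ (2^j) * dl j := by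
    unfold dl; rw [← mul_pow]; norm_num
  rw [h1]
  have h2 := dl_anti h.le
  have h3 : (1/8 : ℝ) ^ (2^j) ≤ (1/8) ^ (j+1) :=
    pow_le_pow_of_le_one (by norm_num) (by norm_num) (Nat.lt_two_pow_self (n := j))
  have := dl_pos j
  gcongr

def Good (α β : ℕ → ℝ) (a : ℝ) (k : ℕ) : Prop := ∀ j ≤ k, ¬ Meets a (a + dl k) (α j) (β j)

open Classical in
lemma count (α β : ℕ → ℝ) (hE : ∀ j, β j - α j ≤ (1/16 : ℝ) ^ (2 ^ j)) (a : ℝ) (k s : ℕ)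
    (hg : Good α β a k) (hk : k < s) (h : ℝ) (hh : 7 * s * h = dl k) (hs : dl s < h / 2)
    (bad : ∀ c < 7 * s, ¬ Good α β (a + c * h) (s + c)) :
    4 * s ≤ ((Finset.Ico s (8 * s)).filter
      (fun j => Meets a (a + dl k) (α j) (β j))).card := by
  have hds := dl_pos s
  have hpos : 0 < h := by linarith
  set H : ℕ → Finset ℕ := fun j => (Finset.range (7 * s)).filter
    (fun c => Meets (a + c * h) (a + c * h + dl (s + c)) (α j) (β j)) with hH
  have hsub : ∀ j c, c ∈ H j → Meets a (a + dl k) (α j) (β j) := by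
    intro j c hc
    simp only [hH, Finset.mem_filter, Finset.mem_range] at hc
    obtain ⟨hc, x, hx, hx'⟩ := hc
    refine ⟨x, ⟨?_, ?_⟩, hx'⟩
    · have : 0 ≤ (c:ℝ) * h := by positivity
      linarith [hx.1]
    · have h1 : (c:ℝ) + 1 ≤ 7 * s := by exact_mod_cast hc
      have h2 : ((c:ℝ) + 1) * h ≤ 7 * s * h := by gcongr
      have h3 := dl_anti (Nat.le_add_right s c)
      linarith [hx.2]
  have hdiff : ∀ j, ∀ c ∈ H j, ∀ c' ∈ H j, ((c : ℝ) - c') * h ≤ (1/16 : ℝ) ^ (2 ^ j) + dl s := by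
    intro j c hc c' hc'
    simp only [hH, Finset.mem_filter, Finset.mem_range] at hc hc'
    obtain ⟨hc, x, hx, hx'⟩ := hc
    obtain ⟨hc', y, hy, hy'⟩ := hc'
    have h3 := dl_anti (Nat.le_add_right s c')
    have := hE j
    have := hx.1; have := hx'.2; have := hy.2; have := hy'.1
    linarith
  have b1 : ∀ j ∈ Finset.range s, ((H j).card : ℝ) ≤ 7 * s * (1/8)^(j+1) + 2 := by
    intro j hj
    by_cases hjk : j ≤ k
    · have : H j = ∅ := by
        apply Finset.eq_empty_of_forall_notMem
        intro c hc
        exact hg j hjk (hsub j c hc)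
      rw [this]; simp; positivity
    · push Not at hjk
      have := card_bound (H j) (7 * s * (1/8)^(j+1) + 1) (by positivity) (by
        intro c hc c' hc'
        have h1 := hdiff j c hc c' hc'
        have h2 := elen hjk
        rw [← hh] at h2
        have h4 : ((c : ℝ) - c') * h ≤ (7 * s * (1/8)^(j+1) + 1) * h := by
          nlinarith
        exact le_of_mul_le_mul_right h4 hpos)
      linarith
  have b2 : ∀ j ∈ Finset.Ico s (8*s), (H j).card ≤
      if Meets a (a + dl k) (α j) (β j) then 1 else 0 := by
    intro j hj
    split_ifs with hm
    · rw [Finset.card_le_one]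
      have key : ∀ c ∈ H j, ∀ c' ∈ H j, c ≤ c' := by
        intro c hc c' hc'
        have h1 := hdiff j c hc c' hc'
        have h2 : (1/16 : ℝ) ^ (2 ^ j) ≤ dl s := by
          refine le_trans ?_ (dl_anti (Finset.mem_Ico.1 hj).1)
          unfold dl
          gcongr; norm_num
        have h3 : ((c : ℝ) - c') * h < 1 * h := by linarith
        have h4 := lt_of_mul_lt_mul_right h3 hpos.le
        have h5 : (c : ℝ) < c' + 1 := by linarith
        have h6 : c < c' + 1 := by exact_mod_cast h5
        omega
      intro c hc c' hc'
      exact le_antisymm (key c hc c' hc') (key c' hc' c hc)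
    · simp only [nonpos_iff_eq_zero, Finset.card_eq_zero]
      apply Finset.eq_empty_of_forall_notMem
      intro c hc
      exact hm (hsub j c hc)
  have cov : Finset.range (7 * s) ⊆ (Finset.range (8 * s)).biUnion H := by
    intro c hc
    have hc' := Finset.mem_range.1 hc
    have := bad c hc'
    unfold Good at this
    push Not at this
    obtain ⟨j, hj, hm⟩ := this
    rw [Finset.mem_biUnion]
    exact ⟨j, Finset.mem_range.2 (by omega), Finset.mem_filter.2 ⟨hc, hm⟩⟩
  have c1 := (Finset.card_le_card cov).trans Finset.card_biUnion_le
  rw [Finset.card_range, ← Finset.sum_range_add_sum_Ico _ (show s ≤ 8 * s by omega)] at c1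
  have c2 := Finset.sum_le_sum b2
  rw [← Finset.card_filter] at c2
  have c3 := Finset.sum_le_sum b1
  rw [Finset.sum_add_distrib, ← Finset.mul_sum] at c3
  simp only [Finset.sum_const, Finset.card_range, nsmul_eq_mul] at c3
  have c4 : 7 * (s:ℝ) * ∑ j ∈ Finset.range s, (1/8 : ℝ) ^ (j+1) ≤ 7 * s * (1/7) := by
    gcongr; exact geo s
  have c5 : (∑ j ∈ Finset.range s, ((H j).card : ℝ)) ≤ 3 * s := by linarith
  have c6 : ∑ j ∈ Finset.range s, (H j).card ≤ 3 * s := by exact_mod_cast c5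
  omega

def LimS (L : ℕ → ℚ) : Set ℝ :=
  {x | ∀ T : ℕ, ∃ i, T ≤ i ∧ x ∈ Icc (L i : ℝ) (L i + dl i)}

lemma nano_limS (L : ℕ → ℚ) : Nanoscopic (LimS L) := by
  intro ε h0 h1
  obtain ⟨m, hm⟩ := exists_pow_lt_of_lt_one h0 (show (1/2:ℝ) < 1 by norm_num)
  have hm2 : (1/2:ℝ)^(2^m) ≤ ε := le_trans
    (pow_le_pow_of_le_one (by norm_num) (by norm_num) (Nat.lt_two_pow_self (n := m)).le) hm.le
  refine ⟨fun k => L (k+m), fun k => L (k+m) + dl (k+m), ?_, ?_⟩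
  · intro x hx
    obtain ⟨i, hi, hx⟩ := hx m
    rw [mem_iUnion]
    refine ⟨i - m, ?_⟩
    simpa [Nat.sub_add_cancel hi] using hx
  · intro k
    have : dl (k+m) = ((1/2:ℝ)^(2^m))^(2^k) := by
      unfold dl; rw [← pow_mul, pow_add, mul_comm]
    simp only [add_sub_cancel_left, this]
    gcongr

lemma branch (α β : ℕ → ℝ) (L : ℕ → ℚ) (lo hi : ℝ)
    (st : ∃ (a : ℚ) (k : ℕ), Good α β a k ∧ lo ≤ a ∧ a + dl k ≤ hi)
    (step : ∀ (a : ℚ) (k : ℕ), Good α β a k → lo ≤ a → a + dl k ≤ hi → ∀ T : ℕ,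
      ∃ i, T ≤ i ∧ Good α β (L i) i ∧ (a:ℝ) ≤ L i ∧ (L i : ℝ) + dl i ≤ a + dl k) :
    ∃ x ∈ LimS L, ∀ j, x ∉ Icc (α j) (β j) := by
  let St := {p : ℚ × ℕ // Good α β p.1 p.2 ∧ lo ≤ p.1 ∧ p.1 + dl p.2 ≤ hi}
  obtain ⟨a0, k0, hst⟩ := st
  have step' : ∀ (T : ℕ) (p : St), ∃ q : St, T ≤ q.1.2 ∧ q.1.1 = L q.1.2 ∧
      (p.1.1:ℝ) ≤ q.1.1 ∧ (q.1.1 : ℝ) + dl q.1.2 ≤ p.1.1 + dl p.1.2 := by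
    rintro T ⟨⟨a, k⟩, h1, h2, h3⟩
    obtain ⟨i, hi1, hg, hl, hr⟩ := step a k h1 h2 h3 T
    exact ⟨⟨(L i, i), hg, h2.trans hl, hr.trans h3⟩, hi1, rfl, hl, hr⟩
  choose f hf1 hf2 hf3 hf4 using step'
  let g : ℕ → St := fun n => Nat.rec (f 0 ⟨(a0, k0), hst⟩) (fun m p => f (m+1) p) n
  have hg0 : ∀ n, n ≤ (g n).1.2 := by
    intro n
    cases n with
    | zero => exact Nat.zero_le _
    | succ m => exact hf1 (m+1) (g m)
  have hgL : ∀ n, (g n).1.1 = L (g n).1.2 := by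
    intro n
    cases n with
    | zero => exact hf2 _ _
    | succ m => exact hf2 (m+1) (g m)
  let I : ℕ → Set ℝ := fun n => Icc ((g n).1.1:ℝ) ((g n).1.1 + dl (g n).1.2)
  have hne : (⋂ n, I n).Nonempty := by
    apply IsCompact.nonempty_iInter_of_sequence_nonempty_isCompact_isClosed
    · intro n
      exact Icc_subset_Icc (hf3 (n+1) (g n)) (hf4 (n+1) (g n))
    · intro n
      exact nonempty_Icc.2 (by linarith [dl_pos (g n).1.2])
    · exact isCompact_Icc
    · intro n; exact isClosed_Icc
  obtain ⟨x, hx⟩ := hne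
  rw [mem_iInter] at hx
  refine ⟨x, ?_, ?_⟩
  · intro T
    refine ⟨(g T).1.2, hg0 T, ?_⟩
    rw [← hgL]
    exact hx T
  · intro j hj
    exact (g j).2.1 j (hg0 j) ⟨x, hx j, hj⟩

def chL (a : ℚ) (k : ℕ) (i : ℕ) : ℚ :=
  a + ((i - 8 ^ Nat.log 8 i : ℕ) : ℚ) * ((1/2) ^ (2 ^ k) / (7 * 8 ^ Nat.log 8 i))

lemma small (k T : ℕ) : ∃ M, ∀ n, M ≤ n →
    T ≤ 8 ^ n ∧ k < 8 ^ n ∧ dl (8 ^ n) < dl k / (7 * 8 ^ n) / 2 := by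
  refine ⟨k + T + 10, fun n hn => ?_⟩
  have h1 : n < 8 ^ n := Nat.lt_pow_self (by norm_num)
  refine ⟨by omega, by omega, ?_⟩
  have key : ∀ s : ℕ, k + 10 < s → dl s < dl k / (7 * s) / 2 := by
    intro s hs
    have hp := dl_pos k
    have h2 : 2 ^ k + (s + 4) ≤ 2 ^ s := by
      obtain ⟨t, rfl⟩ : ∃ t, s = t + 1 := ⟨s - 1, by omega⟩
      have h3 : 2 ^ k ≤ 2 ^ t := Nat.pow_le_pow_right (by norm_num) (by omega)
      have h4 : t + 5 ≤ 2 ^ t := by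
        obtain ⟨u, rfl⟩ : ∃ u, t = u + 3 := ⟨t - 3, by omega⟩
        have := Nat.lt_two_pow_self (n := u)
        rw [pow_add]; omega
      rw [pow_succ]; omega
    have h5 : dl s ≤ dl k * (1/2) ^ (s + 4) := by
      unfold dl
      rw [← pow_add]
      exact pow_le_pow_of_le_one (by norm_num) (by norm_num) h2
    have h6 : (s : ℝ) < 2 ^ s := by exact_mod_cast Nat.lt_two_pow_self (n := s)
    have hs0 : (0:ℝ) < s := by exact_mod_cast (by omega : 0 < s)
    have h7 : (1/2 : ℝ) ^ s < 1 / s := by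
      rw [one_div_pow]; exact one_div_lt_one_div_of_lt hs0 h6
    have h8 : dl k * (1/2) ^ (s + 4) < dl k * (1 / s) / 16 := by
      rw [pow_add]
      have := mul_lt_mul_of_pos_left h7 hp
      norm_num at this ⊢
      linarith
    have h9 : dl k / (7 * s) / 2 = dl k * (1 / s) / 14 := by field_simp; norm_num
    have h10 : 0 < dl k * (1 / s) := by positivity
    rw [h9]
    linarith
  have := key (8 ^ n) (by omega)
  push_cast at this
  exact this

theorem stmt12 :
    ∃ A B : Set ℝ, Nanoscopic A ∧ Nanoscopic B ∧ ¬ Nanoscopic (A ∪ B) := by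
  obtain ⟨e, he⟩ := exists_surjective_nat ((ℚ × ℕ) × (ℚ × ℕ))
  let LA : ℕ → ℚ := fun i =>
    let p := e (Nat.log 8 i).unpair.1
    chL p.1.1 p.1.2 i
  let LB : ℕ → ℚ := fun i =>
    let p := e (Nat.log 8 i).unpair.1
    chL p.2.1 p.2.2 i
  refine ⟨LimS LA, LimS LB, nano_limS _, nano_limS _, fun hN => ?_⟩
  obtain ⟨α, β, hcov, hE⟩ := hN (1/16) (by norm_num) (by norm_num)
  simp only at hE
  have start : ∀ lo : ℚ, ∃ (a : ℚ) (k : ℕ), Good α β a k ∧ (lo:ℝ) ≤ a ∧ a + dl k ≤ lo + 2 := by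
    intro lo
    have d0 : dl 0 = 1/2 := by simp [dl]
    by_cases h : Good α β lo 0
    · exact ⟨lo, 0, h, le_rfl, by rw [d0]; linarith⟩
    · refine ⟨lo + 1, 0, ?_, by push_cast; linarith, by rw [d0]; push_cast; linarith⟩
      unfold Good at h
      push Not at h
      obtain ⟨j, hj, x, hx, hx'⟩ := h
      rintro j' hj' ⟨y, hy, hy'⟩
      obtain rfl : j = 0 := by omega
      obtain rfl : j' = 0 := by omega
      have := hE 0
      rw [d0] at hx hy
      push_cast at hy
      have := hx.2; have := hy.1; have := hx'.1; have := hy'.2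
      norm_num at *
      linarith
  have main : ∀ (a b : ℚ) (k l : ℕ), Good α β a k → Good α β b l → (a:ℝ) + dl k ≤ 2 →
      (3:ℝ) ≤ b → ∀ T : ℕ,
      (∃ i, T ≤ i ∧ Good α β (LA i) i ∧ (a:ℝ) ≤ LA i ∧ (LA i : ℝ) + dl i ≤ a + dl k) ∨
      (∃ i, T ≤ i ∧ Good α β (LB i) i ∧ (b:ℝ) ≤ LB i ∧ (LB i : ℝ) + dl i ≤ b + dl l) := by
    intro a b k l ga gb ha hb T
    obtain ⟨M1, hM1⟩ := small k T
    obtain ⟨M2, hM2⟩ := small l T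
    obtain ⟨r, hr⟩ := he ((a, k), (b, l))
    set n := Nat.pair r (M1 + M2) with hn
    have hnM : M1 + M2 ≤ n := Nat.right_le_pair _ _
    have hnr : n.unpair.1 = r := by rw [hn, Nat.unpair_pair]
    obtain ⟨hT, hk, hsk⟩ := hM1 n (by omega)
    obtain ⟨-, hl, hsl⟩ := hM2 n (by omega)
    have hlog : ∀ c < 7 * 8 ^ n, Nat.log 8 (8 ^ n + c) = n := by
      intro c hc
      apply Nat.log_eq_of_pow_le_of_lt_pow
      · omega
      · rw [pow_succ]; omega
    have hLA : ∀ c < 7 * 8 ^ n, (LA (8 ^ n + c) : ℝ) = a + c * (dl k / (7 * 8 ^ n)) := by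
      intro c hc
      simp only [LA, chL, hlog c hc, hnr, hr, Nat.add_sub_cancel_left, dl]
      push_cast [Nat.add_sub_cancel_left]
      rfl
    have hLB : ∀ c < 7 * 8 ^ n, (LB (8 ^ n + c) : ℝ) = b + c * (dl l / (7 * 8 ^ n)) := by
      intro c hc
      simp only [LB, chL, hlog c hc, hnr, hr, Nat.add_sub_cancel_left, dl]
      push_cast [Nat.add_sub_cancel_left]
      rfl
    have inside : ∀ (k c : ℕ) (a : ℝ), dl (8 ^ n) < dl k / (7 * 8 ^ n) / 2 → c < 7 * 8 ^ n →
        a ≤ a + c * (dl k / (7 * 8 ^ n)) ∧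
        a + c * (dl k / (7 * 8 ^ n)) + dl (8 ^ n + c) ≤ a + dl k := by
      intro k c a hs hc
      have hp := dl_pos k
      have h3 := dl_anti (Nat.le_add_right (8 ^ n) c)
      have hq : 0 < dl k / (7 * 8 ^ n) := by positivity
      have h1 : (c:ℝ) + 1 ≤ 7 * 8 ^ n := by exact_mod_cast hc
      have h2 : ((c:ℝ) + 1) * (dl k / (7 * 8 ^ n)) ≤ 7 * 8 ^ n * (dl k / (7 * 8 ^ n)) := by gcongr
      rw [mul_div_cancel₀ _ (by positivity)] at h2
      constructor
      · have : 0 ≤ c * (dl k / (7 * 8 ^ n)) := by positivity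
        linarith
      · linarith
    by_contra hcon
    push Not at hcon
    obtain ⟨hA, hB⟩ := hcon
    classical
    have cA := count α β hE a k (8 ^ n) ga hk (dl k / (7 * 8 ^ n))
      (by push_cast; exact mul_div_cancel₀ _ (by positivity)) hsk (by
        intro c hc hgood
        rw [← hLA c hc] at hgood
        have h1 := hA (8 ^ n + c) (by omega) hgood
        have h2 := inside k c a hsk hc
        rw [← hLA c hc] at h2
        exact absurd h2.2 (not_le.2 (h1 h2.1)))
    have cB := count α β hE b l (8 ^ n) gb hl (dl l / (7 * 8 ^ n))
      (by push_cast; exact mul_div_cancel₀ _ (by positivity)) hsl (by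
        intro c hc hgood
        rw [← hLB c hc] at hgood
        have h1 := hB (8 ^ n + c) (by omega) hgood
        have h2 := inside l c b hsl hc
        rw [← hLB c hc] at h2
        exact absurd h2.2 (not_le.2 (h1 h2.1)))
    have hdis : Disjoint
        ((Finset.Ico (8 ^ n) (8 * 8 ^ n)).filter (fun j => Meets a (a + dl k) (α j) (β j)))
        ((Finset.Ico (8 ^ n) (8 * 8 ^ n)).filter (fun j => Meets b (b + dl l) (α j) (β j))) := by
      rw [Finset.disjoint_filter]
      rintro j - ⟨x, hx, hx'⟩ ⟨y, hy, hy'⟩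
      have h1 := hE j
      have h2 : (1/16:ℝ) ^ (2 ^ j) < 1 :=
        pow_lt_one₀ (by norm_num) (by norm_num) (by positivity)
      have := hx.2; have := hy.1; have := hx'.1; have := hy'.2
      linarith
    have hun := Finset.card_union_of_disjoint hdis
    have hle := Finset.card_le_card (Finset.union_subset
      (Finset.filter_subset (fun j => Meets a (a + dl k) (α j) (β j))
        (Finset.Ico (8 ^ n) (8 * 8 ^ n)))
      (Finset.filter_subset (fun j => Meets b (b + dl l) (α j) (β j))
        (Finset.Ico (8 ^ n) (8 * 8 ^ n))))
    rw [Nat.card_Ico] at hle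
    have : 0 < 8 ^ n := by positivity
    omega
  have contra : ∀ x ∈ LimS LA ∪ LimS LB, ¬ ∀ j, x ∉ Icc (α j) (β j) := by
    intro x hx h
    obtain ⟨j, hj⟩ := mem_iUnion.1 (hcov hx)
    exact h j hj
  by_cases hall : ∀ (a : ℚ) (k : ℕ), Good α β a k → (0:ℝ) ≤ a → (a:ℝ) + dl k ≤ 2 → ∀ T : ℕ,
      ∃ i, T ≤ i ∧ Good α β (LA i) i ∧ (a:ℝ) ≤ LA i ∧ (LA i : ℝ) + dl i ≤ a + dl k
  · obtain ⟨x, hx, hx'⟩ := branch α β LA 0 2 (by simpa using start 0) hall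
    exact contra x (Or.inl hx) hx'
  · push Not at hall
    obtain ⟨a, k, ga, ha0, ha, T, hT⟩ := hall
    obtain ⟨x, hx, hx'⟩ := branch α β LB 3 5 (by have := start 3; norm_num at this; exact this) (by
      intro b l gb hb hb' T'
      rcases main a b k l ga gb ha hb (max T T') with ⟨i, hi, h1, h2, h3⟩ | ⟨i, hi, h⟩
      · exact absurd h3 (not_le.2 (hT i ((le_max_left _ _).trans hi) h1 h2))
      · exact ⟨i, (le_max_right _ _).trans hi, h⟩)
    exact contra x (Or.inr hx) hx'
end

section
/- There exists a compact subset X of ℝ that is 2-nanoscopic but not nanoscopic. -/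
open Set MeasureTheory

noncomputable def lam (k : ℕ) : ℝ := (1/256 : ℝ) ^ (2 ^ k)

lemma lam_pos (k : ℕ) : 0 < lam k := by unfold lam; positivity

lemma lam_anti {i j : ℕ} (h : i ≤ j) : lam j ≤ lam i := by
  unfold lam
  exact pow_le_pow_of_le_one (by norm_num) (by norm_num) (Nat.pow_le_pow_right (by norm_num) h)

lemma lam_add (s k : ℕ) : lam (s + k) = lam s ^ (2 ^ k) := by
  unfold lam
  rw [← pow_mul, pow_add]

lemma lam_eq (k : ℕ) : lam k = (1/2 : ℝ) ^ (2 ^ (k + 3)) := by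
  unfold lam
  rw [pow_add, mul_comm, pow_mul]
  norm_num

noncomputable def lft (c : ℕ) : ℝ :=
  if h : c ≤ 1 then 0 else
    lft (Nat.log 2 c) + ((c : ℝ) - 2 ^ (Nat.log 2 c)) * (3 * lam (2 ^ (Nat.log 2 (Nat.log 2 c))))
termination_by c
decreasing_by exact Nat.log_lt_self 2 (by omega)

noncomputable def J (c : ℕ) : Set ℝ := Icc (lft c) (lft c + lam (c / 2))

lemma log_child {m c : ℕ} (h1 : 2 ^ m ≤ c) (h2 : c < 2 ^ (m + 1)) : Nat.log 2 c = m :=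
  Nat.log_eq_of_pow_le_of_lt_pow h1 h2

lemma lft_child {m c : ℕ} (hm : 1 ≤ m) (h1 : 2 ^ m ≤ c) (h2 : c < 2 ^ (m + 1)) :
    lft c = lft m + ((c : ℝ) - 2 ^ m) * (3 * lam (2 ^ (Nat.log 2 m))) := by
  have : ¬ c ≤ 1 := by
    have : 2 ^ 1 ≤ 2 ^ m := Nat.pow_le_pow_right (by norm_num) hm
    omega
  rw [lft, dif_neg this, log_child h1 h2]

lemma child_small {m c : ℕ} (hm : 1 ≤ m) (h1 : 2 ^ m ≤ c) :
    lam (c / 2) ≤ lam (2 ^ (Nat.log 2 m)) := by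
  apply lam_anti
  have h : Nat.log 2 m < m := Nat.log_lt_self 2 (by omega)
  have h3 : 2 ^ (Nat.log 2 m + 1) ≤ 2 ^ m := Nat.pow_le_pow_right (by norm_num) h
  rw [pow_succ] at h3
  omega

lemma fit {m : ℕ} (hm : 1 ≤ m) :
    (2:ℝ) ^ m * (3 * lam (2 ^ (Nat.log 2 m))) ≤ lam (m / 2) := by
  set p := Nat.log 2 m with hp
  have hlt : m < 2 ^ (p + 1) := Nat.lt_pow_succ_log_self (by norm_num) m
  have hq : ∃ q, 2 ^ p = q + 1 := ⟨2 ^ p - 1, by have := Nat.one_le_two_pow (n := p); omega⟩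
  obtain ⟨q, hq⟩ := hq
  have h1 : lam q ≤ lam (m / 2) := lam_anti (by rw [pow_succ] at hlt; omega)
  refine le_trans ?_ h1
  have hpq : p ≤ q := by have := Nat.lt_two_pow_self (n := p); omega
  rw [hq, lam_add, lam_eq]
  set A : ℝ := (1/2 : ℝ) ^ (2 ^ (q + 3)) with hA
  have hA0 : 0 < A := by positivity
  have h4 : m + 2 ≤ 2 ^ (q + 3) := by
    have : 2 ^ (p + 1) ≤ 2 ^ (q + 1) := Nat.pow_le_pow_right (by norm_num) (by omega)
    have e : 2 ^ (q + 3) = 4 * 2 ^ (q + 1) := by ring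
    omega
  have h5 : A ≤ (1/2 : ℝ) ^ (m + 2) := pow_le_pow_of_le_one (by norm_num) (by norm_num) h4
  have h6 : (2:ℝ) ^ (m + 2) * (1/2 : ℝ) ^ (m + 2) = 1 := by rw [← mul_pow]; norm_num
  have h7 : (2:ℝ) ^ (m + 2) * A ≤ 1 := by
    rw [← h6]; gcongr
  have h8 : (2:ℝ) ^ (m + 2) = 4 * 2 ^ m := by ring
  rw [h8] at h7
  have h9 : (2:ℝ)^m * A * 3 ≤ 1 := by
    have : 0 < (2:ℝ)^m * A := by positivity
    nlinarith
  calc (2:ℝ) ^ m * (3 * A ^ 2 ^ 1) = (2 ^ m * A * 3) * A := by ring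
    _ ≤ 1 * A := by gcongr
    _ = A := one_mul A

lemma J_child {m c : ℕ} (hm : 1 ≤ m) (h1 : 2 ^ m ≤ c) (h2 : c < 2 ^ (m + 1)) :
    J c ⊆ J m := by
  unfold J
  have hL := lam_pos (2 ^ (Nat.log 2 m))
  have hs := child_small hm h1
  have hf := fit hm
  have hc1 : (2:ℝ) ^ m ≤ c := by exact_mod_cast h1
  have hc2 : (c:ℝ) + 1 ≤ 2 ^ m * 2 := by
    have : c + 1 ≤ 2 ^ m * 2 := by rw [pow_succ] at h2; omega
    exact_mod_cast this
  apply Icc_subset_Icc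
  · rw [lft_child hm h1 h2]
    have : 0 ≤ ((c : ℝ) - 2 ^ m) * (3 * lam (2 ^ (Nat.log 2 m))) :=
      mul_nonneg (by linarith) (by linarith)
    linarith
  · rw [lft_child hm h1 h2]
    have : ((c : ℝ) - 2 ^ m + 1) * (3 * lam (2 ^ (Nat.log 2 m))) ≤
       2 ^ m * (3 * lam (2 ^ (Nat.log 2 m))) := by
      apply mul_le_mul_of_nonneg_right <;> linarith
    linarith

def tw : ℕ → ℕ
  | 0 => 1
  | g + 1 => 2 ^ tw g

lemma le_tw (g : ℕ) : g + 1 ≤ tw g := by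
  induction g with
  | zero => simp [tw]
  | succ g ih =>
    have : tw g < 2 ^ tw g := Nat.lt_two_pow_self
    simp only [tw]; omega

noncomputable def XX : Set ℝ := ⋂ g : ℕ, ⋃ c ∈ Finset.Ico (tw g) (tw (g + 1)), J c

lemma XX_compact : IsCompact XX := by
  apply IsCompact.of_isClosed_subset (s := ⋃ c ∈ Finset.Ico (tw 0) (tw (0 + 1)), J c)
  · exact Finset.isCompact_biUnion _ (fun c _ => isCompact_Icc)
  · apply isClosed_iInter
    intro g
    exact (Finset.isCompact_biUnion _ (fun c _ => isCompact_Icc)).isClosed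
  · exact iInter_subset _ 0

lemma XX_two : TwoNanoscopic XX := by
  intro ε h0 h1
  obtain ⟨s, hs⟩ : ∃ s, lam s ≤ ε := by
    obtain ⟨n, hn⟩ := exists_pow_lt_of_lt_one h0 (show (1/256:ℝ) < 1 by norm_num)
    refine ⟨n, le_trans ?_ hn.le⟩
    exact pow_le_pow_of_le_one (by norm_num) (by norm_num) Nat.lt_two_pow_self.le
  refine ⟨fun i => lft (i + 2 * s), fun i => lft (i + 2 * s) + lam ((i + 2 * s) / 2), ?_, ?_⟩
  · intro y hy
    have := mem_iInter.1 hy (2 * s)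
    simp only [mem_iUnion, Finset.mem_Ico] at this
    obtain ⟨c, ⟨hc, -⟩, hy⟩ := this
    have h := le_tw (2 * s)
    refine mem_iUnion.2 ⟨c - 2 * s, ?_⟩
    have e : c - 2 * s + 2 * s = c := by omega
    simp only [e]
    exact hy
  · intro k j hj
    have e : (2 * k + j + 2 * s) / 2 = s + k := by omega
    simp only [e, add_sub_cancel_left]
    rw [lam_add]
    exact pow_le_pow_left₀ (lam_pos s).le hs _

lemma step (a b : ℕ → ℝ) (hab : ∀ k, b k - a k ≤ lam (k + 1)) (m : ℕ) (hm : 1 ≤ m) :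
    ∃ c, 2 ^ m ≤ c ∧ c < 2 ^ (m + 1) ∧
      ∀ k, 2 ^ (Nat.log 2 m) ≤ k + 1 → k + 1 < 2 ^ m → ∀ y ∈ J c, y ∉ Icc (a k) (b k) := by
  by_contra! H
  have H' : ∀ c ∈ Finset.Ico (2 ^ m) (2 ^ (m + 1)), ∃ k,
      (2 ^ (Nat.log 2 m) ≤ k + 1 ∧ k + 1 < 2 ^ m) ∧ ∃ y ∈ J c, y ∈ Icc (a k) (b k) := by
    intro c hc
    rw [Finset.mem_Ico] at hc
    obtain ⟨k, h1, h2, y, h3, h4⟩ := H c hc.1 hc.2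
    exact ⟨k, ⟨h1, h2⟩, y, h3, h4⟩
  choose! f hf using H'
  have key : ∀ c ∈ Finset.Ico (2 ^ m) (2 ^ (m + 1)), ∀ c' ∈ Finset.Ico (2 ^ m) (2 ^ (m + 1)),
      c < c' → f c ≠ f c' := by
    intro c hc c' hc' hlt he
    obtain ⟨⟨h1, -⟩, y, hy, hyI⟩ := hf c hc
    obtain ⟨-, z, hz, hzI⟩ := hf c' hc'
    rw [← he] at hzI
    rw [Finset.mem_Ico] at hc hc'
    have hl := hab (f c)
    have hl2 := lam_anti h1
    have hL := lam_pos (2 ^ (Nat.log 2 m))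
    have hs := child_small hm hc.1
    have e1 := lft_child hm hc.1 hc.2
    have e2 := lft_child hm hc'.1 hc'.2
    have hcc : (c:ℝ) + 1 ≤ c' := by exact_mod_cast hlt
    have h3 : ((c:ℝ) - 2 ^ m + 1) * (3 * lam (2 ^ (Nat.log 2 m))) ≤
       ((c':ℝ) - 2 ^ m) * (3 * lam (2 ^ (Nat.log 2 m))) := by
      apply mul_le_mul_of_nonneg_right <;> linarith
    have := hy.2
    have := hz.1
    have := hyI.1
    have := hzI.2
    linarith
  have hcard : (Finset.range (2 ^ m - 1)).card < (Finset.Ico (2 ^ m) (2 ^ (m + 1))).card := by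
    have := Nat.one_le_two_pow (n := m)
    rw [Finset.card_range, Nat.card_Ico, pow_succ]; omega
  obtain ⟨c, hc, c', hc', hne, he⟩ := Finset.exists_ne_map_eq_of_card_lt_of_maps_to hcard
    (f := f) (by
      intro c hc
      have := (hf c hc).1.2
      simp only [Finset.coe_range, mem_Iio]; omega)
  rcases lt_or_gt_of_ne hne with h | h
  · exact key c hc c' hc' h he
  · exact key c' hc' c hc h he.symm

lemma XX_not : ¬ Nanoscopic XX := by
  intro hN
  have h1 : lam 1 < 1 := by unfold lam; norm_num
  obtain ⟨a, b, hcov, hab⟩ := hN (lam 1) (lam_pos 1) h1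
  have hab' : ∀ k, b k - a k ≤ lam (k + 1) := by
    intro k; rw [add_comm k 1, lam_add]; exact hab k
  choose! nx hn1 hn2 hn3 using step a b hab'
  let m : ℕ → ℕ := fun i => Nat.rec 1 (fun _ v => nx v) i
  have ms : ∀ i, m (i + 1) = nx (m i) := fun i => rfl
  have mt : ∀ i, tw i ≤ m i ∧ m i < tw (i + 1) := by
    intro i
    induction i with
    | zero => simp [m, tw]
    | succ i ih =>
      have hp : 1 ≤ m i := by have := le_tw i; omega
      rw [ms]
      exact ⟨(Nat.pow_le_pow_right (by norm_num) ih.1).trans (hn1 _ hp),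
        (hn2 _ hp).trans_le (Nat.pow_le_pow_right (by norm_num) ih.2)⟩
  have hp : ∀ i, i + 1 ≤ m i := fun i => (le_tw i).trans (mt i).1
  have hp1 : ∀ i, 1 ≤ m i := fun i => by have := hp i; omega
  have hne : (⋂ i, J (m i)).Nonempty := by
    apply IsCompact.nonempty_iInter_of_sequence_nonempty_isCompact_isClosed
    · intro i
      rw [ms]
      exact J_child (hp1 i) (hn1 _ (hp1 i)) (hn2 _ (hp1 i))
    · intro i
      exact nonempty_Icc.2 (by have := lam_pos (m i / 2); linarith)
    · exact isCompact_Icc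
    · intro i; exact isClosed_Icc
  obtain ⟨y, hy⟩ := hne
  rw [mem_iInter] at hy
  have hyX : y ∈ XX := by
    refine mem_iInter.2 fun g => ?_
    simp only [mem_iUnion, Finset.mem_Ico]
    exact ⟨m g, mt g, hy g⟩
  obtain ⟨k, hk⟩ := mem_iUnion.1 (hcov hyX)
  have hex : ∃ i, k + 1 < 2 ^ m i :=
    ⟨k, by have := hp k; have := Nat.lt_two_pow_self (n := m k); omega⟩
  classical
  have hi := Nat.find_spec hex
  have hmin := fun j => Nat.find_min hex (m := j)
  generalize Nat.find hex = i at hi hmin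
  refine hn3 (m i) (hp1 i) k ?_ hi y (by rw [← ms]; exact hy (i + 1)) hk
  cases i with
  | zero => simp [m]
  | succ i =>
    have := hmin i (by omega)
    rw [ms, log_child (hn1 _ (hp1 i)) (hn2 _ (hp1 i))]
    omega

theorem stmt14 :
    ∃ X : Set ℝ, IsCompact X ∧ TwoNanoscopic X ∧ ¬ Nanoscopic X :=
  ⟨XX, XX_compact, XX_two, XX_not⟩
end

section
/- The family of picoscopic subsets of ℝ is not an ideal: there exist picoscopic sets A, B ⊆ ℝ such that A ∪ B is not picoscopic. -/
open Set MeasureTheory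

open Finset in
lemma hits_card (x h δ α β l : ℝ) (L : ℕ) (hh : 0 < h) (hL : 0 < L) (F : Finset ℕ)
    (hab : β - α ≤ l) (hl : 0 ≤ l) (hδ : 0 ≤ δ)
    (hF : ∀ i ∈ F, ∃ t, α ≤ t ∧ t ≤ β ∧ x + h * i / L ≤ t ∧ t ≤ x + h * i / L + δ) :
    (F.card : ℝ) ≤ 1 + (l + δ) * L / h := by
  have hL' : (0:ℝ) < L := by exact_mod_cast hL
  rcases F.eq_empty_or_nonempty with h0 | hne
  · subst h0
    simp only [Finset.card_empty, Nat.cast_zero]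
    positivity
  · obtain ⟨t, t1, t2, t3, t4⟩ := hF _ (F.min'_mem hne)
    obtain ⟨u, u1, u2, u3, u4⟩ := hF _ (F.max'_mem hne)
    have hle : F.min' hne ≤ F.max' hne := F.min'_le_max' hne
    set i := F.min' hne with hi
    set j := F.max' hne with hj
    have hsub : F ⊆ Finset.Icc i j := fun k hk =>
      Finset.mem_Icc.2 ⟨F.min'_le k hk, F.le_max' k hk⟩
    have hc := Finset.card_le_card hsub
    rw [Nat.card_Icc] at hc
    have hc' : (F.card : ℝ) + i ≤ j + 1 := by
      have : F.card + i ≤ j + 1 := by omega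
      exact_mod_cast this
    have key : h * j / L - h * i / L ≤ l + δ := by linarith
    have e : h * j / L - h * i / L = ((j:ℝ) - i) * h / L := by ring
    rw [e, div_le_iff₀ hL'] at key
    have : (j:ℝ) - i ≤ (l + δ) * L / h := by
      rw [le_div_iff₀ hh]; exact key
    linarith

lemma len_decay (M i : ℕ) :
    ((1:ℝ)/16) ^ (Nat.factorial (M + i + 1)) ≤ (1/16) ^ (Nat.factorial (M+1)) * (1/2)^i := by
  have h1 : Nat.factorial (M+1) + i ≤ Nat.factorial (M + i + 1) := by
    induction i with
    | zero => simp
    | succ i ih =>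
      have : Nat.factorial (M + i + 1) < Nat.factorial (M + (i + 1) + 1) :=
        (Nat.factorial_lt (by omega)).2 (by omega)
      omega
  calc ((1:ℝ)/16) ^ (Nat.factorial (M + i + 1)) ≤ (1/16) ^ (Nat.factorial (M+1) + i) :=
        pow_le_pow_of_le_one (by norm_num) (by norm_num) h1
    _ = (1/16) ^ (Nat.factorial (M+1)) * (1/16)^i := pow_add _ _ _
    _ ≤ _ := by gcongr; norm_num

lemma geom_two (n : ℕ) : ∑ i ∈ Finset.range n, ((1:ℝ)/2)^i ≤ 2 := by
  have : ∑ i ∈ Finset.range n, ((1:ℝ)/2)^i = 2 - 2 * (1/2)^n := by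
    induction n with
    | zero => simp
    | succ n ih => rw [Finset.sum_range_succ, ih]; ring
  rw [this]
  have : (0:ℝ) ≤ (1/2)^n := by positivity
  linarith

lemma len_tail (M Q : ℕ) :
    ∑ k ∈ Finset.range Q, (if k < M then 0 else ((1:ℝ)/16) ^ (Nat.factorial (k + 1)))
      ≤ 2 * (1/16) ^ (Nat.factorial (M+1)) := by
  have h1 : ∑ k ∈ Finset.range Q, (if k < M then 0 else ((1:ℝ)/16) ^ (Nat.factorial (k + 1)))
      ≤ ∑ k ∈ Finset.range (M + Q),
        (if k < M then 0 else ((1:ℝ)/16) ^ (Nat.factorial (k + 1))) := by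
    apply Finset.sum_le_sum_of_subset_of_nonneg
    · intro k; simp only [Finset.mem_range]; omega
    · intro k _ _; split_ifs <;> positivity
  refine h1.trans ?_
  rw [Finset.sum_range_add]
  have h2 : ∑ k ∈ Finset.range M,
      (if k < M then 0 else ((1:ℝ)/16) ^ (Nat.factorial (k + 1))) = 0 := by
    apply Finset.sum_eq_zero
    intro k hk
    rw [if_pos (Finset.mem_range.1 hk)]
  rw [h2, zero_add]
  calc _ ≤ ∑ i ∈ Finset.range Q, ((1:ℝ)/16) ^ (Nat.factorial (M+1)) * (1/2)^i := by
        apply Finset.sum_le_sum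
        intro i _
        rw [if_neg (by omega)]
        exact len_decay M i
    _ = (1/16) ^ (Nat.factorial (M+1)) * ∑ i ∈ Finset.range Q, ((1:ℝ)/2)^i := by
        rw [Finset.mul_sum]
    _ ≤ (1/16) ^ (Nat.factorial (M+1)) * 2 := by
        gcongr; exact geom_two Q
    _ = _ := by ring

def US (z : ℕ → ℝ) (n : ℕ) : Set ℝ :=
  ⋃ k, Set.Icc (z k) (z k + (1/2) ^ ((n+1) * Nat.factorial (k+1)))

lemma pico_US (z : ℕ → ℝ) : Picoscopic (⋂ n, US z n) := by
  intro ε h0 h1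
  obtain ⟨n, hn⟩ := exists_pow_lt_of_lt_one h0 (show (1:ℝ)/2 < 1 by norm_num)
  refine ⟨z, fun k => z k + (1/2) ^ ((n+1) * Nat.factorial (k+1)), Set.iInter_subset _ n, ?_⟩
  intro k
  simp only [add_sub_cancel_left]
  rw [pow_mul]
  apply pow_le_pow_left₀ (by positivity)
  refine le_trans ?_ hn.le
  exact pow_le_pow_of_le_one (by norm_num) (by norm_num) (by omega)

noncomputable def zz (e : ℕ → ℚ × ℚ) (k : ℕ) : ℝ :=
  ((e (Nat.log 4 k)).1 : ℝ) + ((e (Nat.log 4 k)).2 : ℝ) *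
    ((k - 4 ^ (Nat.log 4 k) : ℕ) : ℝ) / ((3 * 4 ^ (Nat.log 4 k) : ℕ) : ℝ)

def PInv (a b : ℕ → ℝ) (c : ℝ) (x h : ℚ) : Prop :=
  0 < h ∧ c ≤ x ∧ (x:ℝ) + h ≤ c + 1 ∧
    ∃ M, (∀ k < M, Disjoint (Set.Icc (a k) (b k)) (Set.Icc (x:ℝ) (x + h))) ∧
      16 * ((1:ℝ)/16) ^ (Nat.factorial (M+1)) ≤ h

def PExt (a b : ℕ → ℝ) (c : ℝ) (z : ℕ → ℝ) (n : ℕ) (x h : ℚ) : Prop :=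
  ∃ x' h' : ℚ, PInv a b c x' h' ∧ Set.Icc (x':ℝ) (x' + h') ⊆ Set.Icc (x:ℝ) (x+h) ∧
    Set.Icc (x':ℝ) (x' + h') ⊆ US z n ∧
    ∀ k ≤ n, Disjoint (Set.Icc (a k) (b k)) (Set.Icc (x':ℝ) (x' + h'))

lemma branch_s15 (a b : ℕ → ℝ) (c : ℝ) (z : ℕ → ℝ) (x h : ℚ) (h0 : PInv a b c x h)
    (H : ∀ n x h, PInv a b c x h → PExt a b c z n x h) :
    ∃ t, t ∈ ⋂ n, US z n ∧ ∀ k, t ∉ Set.Icc (a k) (b k) := by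
  have H' : ∀ (n : ℕ) (p : {p : ℚ × ℚ // PInv a b c p.1 p.2}),
      ∃ q : {p : ℚ × ℚ // PInv a b c p.1 p.2},
        Set.Icc (q.1.1:ℝ) (q.1.1 + q.1.2) ⊆ Set.Icc (p.1.1:ℝ) (p.1.1+p.1.2) ∧
        Set.Icc (q.1.1:ℝ) (q.1.1 + q.1.2) ⊆ US z n ∧
        ∀ k ≤ n, Disjoint (Set.Icc (a k) (b k)) (Set.Icc (q.1.1:ℝ) (q.1.1 + q.1.2)) := by
    rintro n ⟨⟨x, h⟩, hp⟩
    obtain ⟨x', h', h1, h2⟩ := H n x h hp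
    exact ⟨⟨⟨x', h'⟩, h1⟩, h2⟩
  choose f hf using H'
  let s : ℕ → {p : ℚ × ℚ // PInv a b c p.1 p.2} := fun n => Nat.rec ⟨(x, h), h0⟩ (fun n p => f n p) n
  have hs : ∀ n, s (n+1) = f n (s n) := fun n => rfl
  let C : ℕ → Set ℝ := fun n => Set.Icc ((s n).1.1:ℝ) ((s n).1.1 + (s n).1.2)
  have hne : (⋂ n, C n).Nonempty := by
    apply IsCompact.nonempty_iInter_of_sequence_nonempty_isCompact_isClosed
    · intro n
      show C (n+1) ⊆ C n
      exact (hf n (s n)).1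
    · intro n
      have : (0:ℚ) < (s n).1.2 := (s n).2.1
      have : (0:ℝ) < (s n).1.2 := by exact_mod_cast this
      exact Set.nonempty_Icc.2 (by linarith)
    · exact isCompact_Icc
    · intro n; exact isClosed_Icc
  obtain ⟨t, ht⟩ := hne
  rw [Set.mem_iInter] at ht
  refine ⟨t, Set.mem_iInter.2 fun n => (hf n (s n)).2.1 (ht (n+1)), fun k hk => ?_⟩
  exact Set.disjoint_left.1 ((hf k (s k)).2.2 k le_rfl) hk (ht (k+1))

lemma side (a b : ℕ → ℝ) (c : ℝ) (e : ℕ → ℚ × ℚ) (n s Q : ℕ) (x h : ℚ)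
    (hab : ∀ k, b k - a k ≤ (1/16) ^ (Nat.factorial (k+1)))
    (hI : PInv a b c x h) (he : e s = (x, h)) (hQ : Q = 4 ^ (s+1)) (hn : n + 1 ≤ Q)
    (hQh : 8 * (Q:ℝ) * (1/2)^Q ≤ h) (hE : ¬ PExt a b c (zz e) n x h) :
    ∃ (g : ℕ → ℕ) (st : ℕ → ℝ), 3 * 4 ^ s ≤ ∑ k ∈ Finset.range Q, g k ∧
      (∀ k, g k ≠ 0 → ∃ t, a k ≤ t ∧ t ≤ b k ∧ c ≤ t ∧ t ≤ c + 1) ∧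
      (∀ k, (g k : ℝ) ≤ 1 + st k) ∧ (∀ k, 0 ≤ st k) ∧
      ∑ k ∈ Finset.range Q, st k ≤ ((3 * 4 ^ s : ℕ) : ℝ) / 4 := by
  classical
  obtain ⟨hh, hcx, hxc, M, hM, hMh⟩ := hI
  have hh' : (0:ℝ) < h := by exact_mod_cast hh
  set L : ℕ := 3 * 4 ^ s with hLdef
  have hL : 0 < L := by positivity
  have hL' : (0:ℝ) < L := by exact_mod_cast hL
  have hLQ : L ≤ Q := by rw [hQ, hLdef, pow_succ]; omega
  have hLQ' : (L:ℝ) ≤ Q := by exact_mod_cast hLQ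
  set δ : ℝ := (1/2) ^ ((n+1) * Nat.factorial Q) with hδ
  have hδ0 : 0 < δ := by positivity
  have hδQ : δ ≤ (1/2)^Q := by
    apply pow_le_pow_of_le_one (by norm_num) (by norm_num)
    calc Q ≤ Nat.factorial Q := Nat.self_le_factorial Q
      _ ≤ _ := Nat.le_mul_of_pos_left _ (by omega)
  have hδh : 8 * (Q:ℝ) * δ ≤ h := le_trans (by gcongr) hQh
  -- each piece
  have piece : ∀ i < L, ((x:ℝ) ≤ x + h * i / L) ∧ (x + h * i / L + δ ≤ x + h) := by
    intro i hi
    have hi' : (i:ℝ) + 1 ≤ L := by exact_mod_cast hi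
    constructor
    · have : 0 ≤ (h:ℝ) * i / L := by positivity
      linarith
    · have h1 : (h:ℝ) * i / L + h / L ≤ h := by
        rw [← add_div, div_le_iff₀ hL']
        nlinarith
      have h2 : δ ≤ h / L := by
        rw [le_div_iff₀ hL']
        nlinarith
      linarith
  have hit : ∀ i < L, ∃ k < Q, ∃ t, a k ≤ t ∧ t ≤ b k ∧
      x + h * i / L ≤ t ∧ t ≤ x + h * i / L + δ := by
    intro i hi
    by_contra hcon
    push Not at hcon
    apply hE
    have hdis : ∀ k < Q, Disjoint (Set.Icc (a k) (b k))
        (Set.Icc ((x:ℝ) + h * i / L) (x + h * i / L + δ)) := by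
      intro k hk
      rw [Set.disjoint_left]
      rintro t ⟨t1, t2⟩ ⟨t3, t4⟩
      exact absurd t4 (not_le.2 (hcon k hk t t1 t2 t3))
    obtain ⟨p1, p2⟩ := piece i hi
    have ex : ((x + h * i / L : ℚ) : ℝ) = x + h * i / L := by push_cast; ring
    have eh : (((1/2) ^ ((n+1) * Nat.factorial Q) : ℚ) : ℝ) = δ := by rw [hδ]; push_cast; ring
    refine ⟨x + h * i / L, (1/2) ^ ((n+1) * Nat.factorial Q), ?_, ?_, ?_, ?_⟩
    · refine ⟨by positivity, ?_, ?_, Q, ?_, ?_⟩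
      · rw [ex]; linarith
      · rw [ex, eh]; linarith
      · intro k hk
        rw [ex, eh]; exact hdis k hk
      · rw [eh, hδ]
        have e1 : (1:ℝ)/16 = (1/2)^4 := by norm_num
        have e2 : (16:ℝ) * (1/2)^4 = 1 := by norm_num
        rw [e1, ← pow_mul]
        have : (n+1) * Nat.factorial Q + 4 ≤ 4 * Nat.factorial (Q+1) := by
          rw [Nat.factorial_succ]
          have := Nat.factorial_pos Q
          nlinarith
        calc (16:ℝ) * (1/2)^(4 * Nat.factorial (Q+1))
            ≤ 16 * (1/2)^((n+1) * Nat.factorial Q + 4) := by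
              have := pow_le_pow_of_le_one (show (0:ℝ) ≤ 1/2 by norm_num) (by norm_num) this
              linarith
          _ = (1/2) ^ ((n+1) * Nat.factorial Q) := by rw [pow_add]; ring
    · rw [ex, eh]
      exact Set.Icc_subset_Icc p1 p2
    · rw [ex, eh]
      refine Set.Subset.trans ?_ (Set.subset_iUnion _ (4^s + i))
      have hlog : Nat.log 4 (4^s + i) = s := by
        rw [Nat.log_eq_iff (Or.inr ⟨by norm_num, by positivity⟩)]
        rw [pow_succ]
        constructor <;> omega
      have hz : zz e (4^s+i) = x + h * i / L := by
        unfold zz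
        rw [hlog, he, hLdef, Nat.add_sub_cancel_left]
      rw [hz]
      apply Set.Icc_subset_Icc le_rfl
      have : δ ≤ (1/2) ^ ((n+1) * Nat.factorial (4^s+i+1)) := by
        apply pow_le_pow_of_le_one (by norm_num) (by norm_num)
        apply Nat.mul_le_mul_left
        apply Nat.factorial_le
        rw [hQ, pow_succ]; omega
      linarith
    · intro k hk
      rw [ex, eh]; exact hdis k (by omega)
  let F : ℕ → Finset ℕ := fun k => (Finset.range L).filter (fun i => ∃ t, a k ≤ t ∧ t ≤ b k ∧
      x + h * i / L ≤ t ∧ t ≤ x + h * i / L + δ)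
  have hF : ∀ k, ∀ i ∈ F k, i < L ∧ ∃ t, a k ≤ t ∧ t ≤ b k ∧
      x + h * i / L ≤ t ∧ t ≤ x + h * i / L + δ := by
    intro k i hi
    simpa [F] using hi
  refine ⟨fun k => (F k).card,
    fun k => if k < M then 0 else ((1/16) ^ (Nat.factorial (k+1)) + δ) * L / h, ?_, ?_, ?_, ?_, ?_⟩
  · calc L = (Finset.range L).card := by simp
      _ ≤ ((Finset.range Q).biUnion F).card := by
        apply Finset.card_le_card
        intro i hi
        obtain ⟨k, hk, ht⟩ := hit i (Finset.mem_range.1 hi)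
        exact Finset.mem_biUnion.2 ⟨k, Finset.mem_range.2 hk, Finset.mem_filter.2 ⟨hi, ht⟩⟩
      _ ≤ _ := Finset.card_biUnion_le
  · intro k hk
    obtain ⟨i, hi⟩ := Finset.card_ne_zero.1 hk
    obtain ⟨hiL, t, t1, t2, t3, t4⟩ := hF k i hi
    obtain ⟨p1, p2⟩ := piece i hiL
    exact ⟨t, t1, t2, by linarith, by linarith⟩
  · intro k
    dsimp only
    split_ifs with hkM
    · have : F k = ∅ := by
        rw [Finset.eq_empty_iff_forall_notMem]
        intro i hi
        obtain ⟨hiL, t, t1, t2, t3, t4⟩ := hF k i hi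
        obtain ⟨p1, p2⟩ := piece i hiL
        exact Set.disjoint_left.1 (hM k hkM) (show t ∈ _ from ⟨t1, t2⟩)
          ⟨by linarith, by linarith⟩
      rw [this]; simp
    · exact hits_card x h δ (a k) (b k) _ L hh' hL (F k) (hab k) (by positivity) hδ0.le
        (fun i hi => (hF k i hi).2)
  · intro k
    dsimp only
    split_ifs <;> positivity
  · calc _ ≤ ∑ k ∈ Finset.range Q,
          ((if k < M then 0 else ((1:ℝ)/16) ^ (Nat.factorial (k + 1))) + δ) * (L / h) := by
          apply Finset.sum_le_sum
          intro k _
          split_ifs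
          · positivity
          · rw [mul_div_assoc]
      _ = (∑ k ∈ Finset.range Q, (if k < M then 0 else ((1:ℝ)/16) ^ (Nat.factorial (k + 1)))
            + Q * δ) * (L / h) := by
          rw [← Finset.sum_mul, Finset.sum_add_distrib]; simp
      _ ≤ (h / 4) * (L / h) := by
          have := len_tail M Q
          gcongr
          linarith
      _ = _ := by field_simp

theorem stmt15 :
    ∃ A B : Set ℝ, Picoscopic A ∧ Picoscopic B ∧ ¬ Picoscopic (A ∪ B) := by
  obtain ⟨f, hf⟩ := exists_surjective_nat ((ℚ × ℚ) × (ℚ × ℚ))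
  let e : ℕ → (ℚ × ℚ) × (ℚ × ℚ) := fun s => f (Nat.unpair s).1
  have he : ∀ d N, ∃ s, N ≤ s ∧ e s = d := by
    intro d N
    obtain ⟨i, hi⟩ := hf d
    exact ⟨Nat.pair i N, Nat.right_le_pair i N, by simp [e, hi]⟩
  let z := zz (fun s => (e s).1)
  let w := zz (fun s => (e s).2)
  refine ⟨⋂ n, US z n, ⋂ n, US w n, pico_US z, pico_US w, fun hP => ?_⟩
  obtain ⟨a, b, hcov, hab⟩ := hP (1/16) (by norm_num) (by norm_num)
  have hnot : ∀ t, t ∈ (⋂ n, US z n) ∪ (⋂ n, US w n) → ¬ ∀ k, t ∉ Set.Icc (a k) (b k) := by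
    intro t ht h
    obtain ⟨k, hk⟩ := Set.mem_iUnion.1 (hcov ht)
    exact h k hk
  have init : ∀ c : ℚ, PInv a b c c 1 := by
    intro c
    refine ⟨by norm_num, le_rfl, by push_cast; exact le_rfl, 0, by simp, ?_⟩
    norm_num
  have hA : ¬ ∀ n x h, PInv a b (0:ℚ) x h → PExt a b (0:ℚ) z n x h := by
    intro H
    obtain ⟨t, ht, hk⟩ := branch_s15 a b _ z _ _ (init 0) H
    exact hnot t (Or.inl ht) hk
  have hB : ¬ ∀ n x h, PInv a b (2:ℚ) x h → PExt a b (2:ℚ) w n x h := by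
    intro H
    obtain ⟨t, ht, hk⟩ := branch_s15 a b _ w _ _ (init 2) H
    exact hnot t (Or.inr ht) hk
  push Not at hA hB
  obtain ⟨n, x, h, hI, hE⟩ := hA
  obtain ⟨m, y, g, hJ, hG⟩ := hB
  have hh : (0:ℝ) < h := by exact_mod_cast hI.1
  have hg : (0:ℝ) < g := by exact_mod_cast hJ.1
  have lim : Filter.Tendsto (fun Q : ℕ => 8 * (Q:ℝ) * (1/2)^Q) Filter.atTop (nhds 0) := by
    have := (tendsto_self_mul_const_pow_of_lt_one (r := (1:ℝ)/2) (by norm_num)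
      (by norm_num)).const_mul 8
    simpa [mul_assoc] using this
  have ev := ((lim.eventually (ge_mem_nhds hh)).and (lim.eventually (ge_mem_nhds hg))).and
    ((Filter.eventually_ge_atTop (n+1)).and (Filter.eventually_ge_atTop (m+1)))
  obtain ⟨N, hN⟩ := Filter.eventually_atTop.1 ev
  obtain ⟨s, hs, hes⟩ := he ((x, h), (y, g)) N
  have hNQ : N ≤ 4 ^ (s+1) := by
    have : s + 1 < 4 ^ (s+1) := Nat.lt_pow_self (by norm_num)
    omega
  obtain ⟨⟨q1, q2⟩, q3, q4⟩ := hN _ hNQ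
  obtain ⟨g1, s1, A1, A2, A3, A4, A5⟩ := side a b _ (fun s => (e s).1) n s _ x h hab hI
    (by simp [hes]) rfl q3 q1 hE
  obtain ⟨g2, s2, B1, B2, B3, B4, B5⟩ := side a b _ (fun s => (e s).2) m s _ y g hab hJ
    (by simp [hes]) rfl q4 q2 hG
  have hk : ∀ k, ((g1 k : ℝ) + g2 k) ≤ 1 + s1 k + s2 k := by
    intro k
    have a3 := A3 k
    have b3 := B3 k
    have a4 := A4 k
    have b4 := B4 k
    by_cases h1 : g1 k = 0
    · rw [h1]; push_cast; linarith
    by_cases h2 : g2 k = 0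
    · rw [h2]; push_cast; linarith
    exfalso
    obtain ⟨t, t1, t2, t3, t4⟩ := A2 k h1
    obtain ⟨u, u1, u2, u3, u4⟩ := B2 k h2
    have : b k - a k ≤ (1/16) ^ 1 := (hab k).trans
      (pow_le_pow_of_le_one (by norm_num) (by norm_num) (Nat.factorial_pos _))
    push_cast at *
    linarith
  have hsum := Finset.sum_le_sum (s := Finset.range (4^(s+1))) (fun k _ => hk k)
  simp only [Finset.sum_add_distrib, Finset.sum_const, Finset.card_range, nsmul_eq_mul,
    mul_one] at hsum
  have A1' : ((3 * 4^s : ℕ) : ℝ) ≤ ∑ k ∈ Finset.range (4^(s+1)), (g1 k : ℝ) := by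
    exact_mod_cast A1
  have B1' : ((3 * 4^s : ℕ) : ℝ) ≤ ∑ k ∈ Finset.range (4^(s+1)), (g2 k : ℝ) := by
    exact_mod_cast B1
  have hp : (0:ℝ) < 4^s := by positivity
  push_cast [pow_succ] at *
  linarith
end

section
/- There exist a picoscopic set X ⊆ ℝ and a point x ∈ ℝ such that X ∪ {x} is not picoscopic. -/
open Set MeasureTheory

namespace Pico

noncomputable section

def dl : ℝ := 1 / 10000
def lam (a : ℕ) : ℝ := dl ^ ((a + 1).factorial)
def len (n a : ℕ) : ℝ := dl ^ ((n + 1) * (a + 1).factorial)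
def root (n a : ℕ) : ℝ := 3 * (Nat.pair n a : ℝ)
def sp (n l : ℕ) : ℝ := if l ≤ n then 1 else lam l
def Sep (u v u' v' s : ℝ) : Prop := v + s < u' ∨ v' + s < u

lemma dl_pos : 0 < dl := by norm_num [dl]
lemma dl_le : dl ≤ 1 := by norm_num [dl]
lemma lam_pos (a : ℕ) : 0 < lam a := pow_pos dl_pos _
lemma len_pos (n a : ℕ) : 0 < len n a := pow_pos dl_pos _
lemma lam_le_one (a : ℕ) : lam a ≤ 1 := pow_le_one₀ dl_pos.le dl_le
lemma len_le_lam (n a : ℕ) : len n a ≤ lam a :=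
  pow_le_pow_of_le_one dl_pos.le dl_le (Nat.le_mul_of_pos_left _ (Nat.succ_pos n))
lemma len_le_one (n a : ℕ) : len n a ≤ 1 := (len_le_lam n a).trans (lam_le_one a)
lemma len_anti {n n' : ℕ} (a : ℕ) (h : n ≤ n') : len n' a ≤ len n a :=
  pow_le_pow_of_le_one dl_pos.le dl_le (Nat.mul_le_mul_right _ (by omega))
lemma lam_anti {a b : ℕ} (h : a ≤ b) : lam b ≤ lam a :=
  pow_le_pow_of_le_one dl_pos.le dl_le (Nat.factorial_le (by omega))
lemma lam_le_pow (a : ℕ) : lam a ≤ dl ^ a :=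
  pow_le_pow_of_le_one dl_pos.le dl_le (by have := Nat.self_le_factorial (a+1); omega)
lemma lam_succ (a : ℕ) : 2 * lam (a + 1) ≤ lam a := by
  have h : lam (a+1) ≤ dl ^ ((a+1).factorial + 1) := by
    apply pow_le_pow_of_le_one dl_pos.le dl_le
    rw [Nat.factorial_succ (a+1)]
    have := Nat.factorial_pos (a+1)
    nlinarith
  rw [pow_succ] at h
  have : 0 < dl ^ ((a+1).factorial) := pow_pos dl_pos _
  have e : lam a = dl ^ ((a+1).factorial) := rfl
  rw [e]
  have : dl = 1/10000 := rfl
  nlinarith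
lemma lam_key (n l : ℕ) : lam (max l n + 1) ≤ dl * len n l := by
  have : dl * len n l = dl ^ ((n + 1) * (l + 1).factorial + 1) := by
    rw [pow_succ, mul_comm]; rfl
  rw [this]
  apply pow_le_pow_of_le_one dl_pos.le dl_le
  rw [Nat.factorial_succ (max l n + 1)]
  have h1 : (l+1).factorial ≤ (max l n + 1).factorial := Nat.factorial_le (by omega)
  have h2 : n ≤ max l n := le_max_right _ _
  have h3 := Nat.factorial_pos (max l n + 1)
  have h4 : (n+1) * (l+1).factorial ≤ (max l n + 1) * (max l n + 1).factorial :=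
    Nat.mul_le_mul (by omega) h1
  nlinarith
lemma lam_sum (a N : ℕ) : ∑ j ∈ Finset.Ico a N, lam j ≤ 2 * lam a := by
  rcases le_total N a with h | h
  · rw [Finset.Ico_eq_empty_of_le h]; simp; exact (lam_pos a).le
  · have : ∑ j ∈ Finset.Ico a N, lam j ≤ 2 * lam a - 2 * lam N := by
      induction N, h using Nat.le_induction with
      | base => simp
      | succ k hk ih =>
        rw [Finset.sum_Ico_succ_top hk]
        have := lam_succ k
        linarith
    have := lam_pos N
    linarith
lemma sp_le_one (n l : ℕ) : sp n l ≤ 1 := by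
  unfold sp; split_ifs; exacts [le_rfl, lam_le_one l]
lemma sp_pos (n l : ℕ) : 0 < sp n l := by
  unfold sp; split_ifs; exacts [one_pos, lam_pos l]
lemma sp_of_lt {n l : ℕ} (h : n < l) : sp n l = lam l := by
  unfold sp; rw [if_neg (by omega)]

lemma Sep.mono {u v u' v' s a b : ℝ} (h : Sep u v u' v' s) (ha : u ≤ a) (hb : b ≤ v) :
    Sep a b u' v' s := by
  rcases h with h | h
  · left; linarith
  · right; linarith

lemma root_nonneg (n a : ℕ) : 0 ≤ root n a := by unfold root; positivity

lemma root_sep {n a n' a' : ℕ} (h : ¬ (n = n' ∧ a = a')) {u v u' v' s : ℝ} (hs : s ≤ 1)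
    (hu : root n a ≤ u) (hv : v ≤ root n a + 1) (hu' : root n' a' ≤ u')
    (hv' : v' ≤ root n' a' + 1) : Sep u v u' v' s := by
  have hne : Nat.pair n a ≠ Nat.pair n' a' := fun e => h (Nat.pair_eq_pair.1 e)
  unfold root at *
  rcases lt_or_gt_of_ne hne with h1 | h1
  · left
    have : ((Nat.pair n a : ℕ) : ℝ) + 1 ≤ Nat.pair n' a' := by exact_mod_cast h1
    linarith
  · right
    have : ((Nat.pair n' a' : ℕ) : ℝ) + 1 ≤ Nat.pair n a := by exact_mod_cast h1
    linarith

structure Dat where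
  n1 : ℕ
  l1 : ℕ
  q1 : ℕ
  n2 : ℕ
  l2 : ℕ
  q2 : ℕ

lemma exists_D : ∃ D : ℕ → Dat, Function.Surjective D := by
  obtain ⟨f, hf⟩ := exists_surjective_nat (ℕ × ℕ × ℕ × ℕ × ℕ × ℕ)
  refine ⟨fun k => ⟨(f k).1, (f k).2.1, (f k).2.2.1, (f k).2.2.2.1, (f k).2.2.2.2.1, (f k).2.2.2.2.2⟩, ?_⟩
  rintro ⟨a, b, c, d, e, g⟩
  obtain ⟨k, hk⟩ := hf (a, b, c, d, e, g)
  exact ⟨k, by simp [hk]⟩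

def D : ℕ → Dat := exists_D.choose
lemma D_surj : Function.Surjective D := exists_D.choose_spec

def tt (a : ℕ) : ℕ := 100 ^ (Nat.log 100 a)
def dt (a : ℕ) : Dat := D (Nat.unpair (Nat.log 100 a)).1

def bX (k κ k' κ' : ℝ) : ℝ := if k + κ / 2 ≤ k' + κ' / 2 then k else k + 2 * κ / 3
def bY (k κ k' κ' : ℝ) : ℝ := if k + κ / 2 ≤ k' + κ' / 2 then k' + 2 * κ' / 3 else k'

def posX (P : ℕ → ℕ → ℝ) (a : ℕ) : ℝ :=
  bX (P (dt a).l1 (dt a).n1) (len (dt a).n1 (dt a).l1) (P (dt a).l2 (dt a).n2) (len (dt a).n2 (dt a).l2)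
    + ((a - tt a : ℕ) : ℝ) * (len (dt a).n1 (dt a).l1 / (297 * (tt a : ℝ)))
def posY (P : ℕ → ℕ → ℝ) (a : ℕ) : ℝ :=
  bY (P (dt a).l1 (dt a).n1) (len (dt a).n1 (dt a).l1) (P (dt a).l2 (dt a).n2) (len (dt a).n2 (dt a).l2)
    + ((a - tt a : ℕ) : ℝ) * (len (dt a).n2 (dt a).l2 / (297 * (tt a : ℝ)))

structure OK (P : ℕ → ℕ → ℝ) (a : ℕ) : Prop where
  l1 : (dt a).l1 < a
  l2 : (dt a).l2 < a
  q12 : (dt a).q1 < (dt a).q2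
  q2 : (dt a).q2 < a
  n2 : (dt a).n2 < (dt a).q2
  n1 : (dt a).n1 < (dt a).q1 ∨ (dt a).n1 = (dt a).q2
  x1 : P (dt a).l1 (dt a).n1 ≤ posX P a
  x2 : posX P a + len (dt a).q1 a ≤ P (dt a).l1 (dt a).n1 + len (dt a).n1 (dt a).l1
  y1 : P (dt a).l2 (dt a).n2 ≤ posY P a
  y2 : posY P a + len (dt a).q2 a ≤ P (dt a).l2 (dt a).n2 + len (dt a).n2 (dt a).l2
  v1 : ∀ i < (dt a).q1, ∃ l < a, P l i ≤ P (dt a).l1 (dt a).n1 ∧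
    P (dt a).l1 (dt a).n1 + len (dt a).n1 (dt a).l1 ≤ P l i + len i l
  v2 : ∀ i < (dt a).q2, ∃ l < a, P l i ≤ P (dt a).l2 (dt a).n2 ∧
    P (dt a).l2 (dt a).n2 + len (dt a).n2 (dt a).l2 ≤ P l i + len i l
  sx : ∀ n, (dt a).q1 ≤ n → ∀ l < a, ¬ (n = (dt a).n1 ∧ l = (dt a).l1) →
    Sep (posX P a) (posX P a + len (dt a).q1 a) (P l n) (P l n + len n l) (sp n l)
  sy : ∀ n, (dt a).q2 ≤ n → ∀ l < a, ¬ (n = (dt a).n2 ∧ l = (dt a).l2) →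
    Sep (posY P a) (posY P a + len (dt a).q2 a) (P l n) (P l n + len n l) (sp n l)
  sxy : Sep (posX P a) (posX P a + len (dt a).q1 a) (posY P a) (posY P a + len (dt a).q2 a) (lam a)

lemma OK.congr {P Q : ℕ → ℕ → ℝ} {a : ℕ} (h : ∀ l < a, P l = Q l) (hP : OK P a) :
    OK Q a ∧ posX P a = posX Q a ∧ posY P a = posY Q a := by
  have e1 := h _ hP.l1
  have e2 := h _ hP.l2
  have eX : posX P a = posX Q a := by unfold posX; rw [e1, e2]
  have eY : posY P a = posY Q a := by unfold posY; rw [e1, e2]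
  refine ⟨⟨hP.l1, hP.l2, hP.q12, hP.q2, hP.n2, hP.n1, ?_, ?_, ?_, ?_, ?_, ?_, ?_, ?_, ?_⟩, eX, eY⟩
  · rw [← eX, ← e1]; exact hP.x1
  · rw [← eX, ← e1]; exact hP.x2
  · rw [← eY, ← e2]; exact hP.y1
  · rw [← eY, ← e2]; exact hP.y2
  · intro i hi
    obtain ⟨l, hl, h3⟩ := hP.v1 i hi
    refine ⟨l, hl, ?_⟩
    rw [← e1, ← h l hl]; exact h3
  · intro i hi
    obtain ⟨l, hl, h3⟩ := hP.v2 i hi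
    refine ⟨l, hl, ?_⟩
    rw [← e2, ← h l hl]; exact h3
  · intro n hn l hl hne
    rw [← eX, ← h l hl]; exact hP.sx n hn l hl hne
  · intro n hn l hl hne
    rw [← eY, ← h l hl]; exact hP.sy n hn l hl hne
  · rw [← eX, ← eY]; exact hP.sxy

def Spec (c : ℕ → ℕ → ℝ) : Prop := ∀ a,
  (OK c a ∧ (∀ n, (dt a).q1 ≤ n → n < (dt a).q2 → c a n = posX c a) ∧ c a (dt a).q2 = posY c a ∧
    ∀ n, (n < (dt a).q1 ∨ (dt a).q2 < n) → c a n = root n a) ∨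
  (¬ OK c a ∧ ∀ n, c a n = root n a)

open Classical in
def Phi (a : ℕ) (P : ℕ → ℕ → ℝ) (n : ℕ) : ℝ :=
  if OK P a then
    (if (dt a).q1 ≤ n ∧ n < (dt a).q2 then posX P a else if n = (dt a).q2 then posY P a else root n a)
  else root n a

lemma exists_c : ∃ c, Spec c := by
  let F : (a : ℕ) → ((l : ℕ) → l < a → (ℕ → ℝ)) → (ℕ → ℝ) := fun a ih =>
    Phi a (fun l => if h : l < a then ih l h else fun _ => 0)
  let c : ℕ → ℕ → ℝ := WellFounded.fix (r := fun a b : ℕ => a < b) Nat.lt_wfRel.wf F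
  have hc : ∀ a, c a = Phi a (fun l => if l < a then c l else fun _ => 0) := by
    intro a
    have := WellFounded.fix_eq (r := fun a b : ℕ => a < b) Nat.lt_wfRel.wf F a
    change c a = F a (fun l _ => c l) at this
    rw [this]
    simp only [F, dite_eq_ite]
  refine ⟨c, fun a => ?_⟩
  set P : ℕ → ℕ → ℝ := (fun l => if l < a then c l else fun _ => 0) with hP
  have hPc : ∀ l < a, P l = c l := by intro l hl; simp [hP, hl]
  by_cases hok : OK P a
  · obtain ⟨h1, h2, h3⟩ := hok.congr hPc
    left
    refine ⟨h1, ?_, ?_, ?_⟩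
    · intro n h4 h5
      rw [hc a, Phi, if_pos hok, if_pos ⟨h4, h5⟩, h2]
    · rw [hc a, Phi, if_pos hok, if_neg (by omega), if_pos rfl, h3]
    · intro n hn
      rw [hc a, Phi, if_pos hok, if_neg (by have := h1.q12; omega), if_neg (by have := h1.q12; omega)]
  · right
    refine ⟨fun h => hok (OK.congr (fun l hl => (hPc l hl).symm) h).1, fun n => ?_⟩
    rw [hc a, Phi, if_neg hok]

def cc : ℕ → ℕ → ℝ := exists_c.choose
lemma cc_spec : Spec cc := exists_c.choose_spec

lemma F0 (a : ℕ) : ∀ n, ∃ n' l', root n' l' ≤ cc a n ∧ cc a n + len n a ≤ root n' l' + 1 ∧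
    ((n' = n ∧ l' = a) ∨ (l' < a ∧ n' < a)) := by
  induction a using Nat.strong_induction_on with
  | _ a ih =>
  intro n
  have fresh : cc a n = root n a → ∃ n' l', root n' l' ≤ cc a n ∧ cc a n + len n a ≤ root n' l' + 1 ∧
    ((n' = n ∧ l' = a) ∨ (l' < a ∧ n' < a)) := by
    intro h
    refine ⟨n, a, h.ge, ?_, Or.inl ⟨rfl, rfl⟩⟩
    rw [h]; have := len_le_one n a; linarith
  rcases cc_spec a with ⟨hok, hx, hy, hr⟩ | ⟨_, hr⟩
  · have q12 := hok.q12
    have q2 := hok.q2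
    by_cases h1 : (dt a).q1 ≤ n ∧ n < (dt a).q2
    · obtain ⟨n', l', h3, h4, h5⟩ := ih _ hok.l1 (dt a).n1
      have e := hx n h1.1 h1.2
      have := hok.x1
      have := hok.x2
      have := len_anti a h1.1
      refine ⟨n', l', by linarith, by linarith, Or.inr ?_⟩
      have := hok.l1
      have := hok.n1
      omega
    · by_cases h2 : n = (dt a).q2
      · obtain ⟨n', l', h3, h4, h5⟩ := ih _ hok.l2 (dt a).n2
        have e : cc a n = posY cc a := by rw [h2]; exact hy
        have := hok.y1
        have := hok.y2
        refine ⟨n', l', by linarith, by rw [h2] at e ⊢; linarith, Or.inr ?_⟩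
        have := hok.l2
        have := hok.n2
        omega
      · exact fresh (hr n (by omega))
  · exact fresh (hr n)

lemma cc_nonneg (a n : ℕ) : 0 ≤ cc a n := by
  obtain ⟨n', l', h, _⟩ := F0 a n
  exact (root_nonneg _ _).trans h

lemma root_sep_cc {n a n' l' : ℕ} {s : ℝ} (hs : s ≤ 1) (h : ¬ (n = n' ∧ a = l'))
    (h2 : a ≤ max l' n') : Sep (cc a n) (cc a n + len n a) (root n' l') (root n' l' + len n' l') s := by
  obtain ⟨n'', l'', h3, h4, h5⟩ := F0 a n
  refine root_sep (n := n'') (a := l'') (n' := n') (a' := l') ?_ hs h3 h4 le_rfl ?_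
  · rintro ⟨rfl, rfl⟩
    rcases h5 with ⟨rfl, rfl⟩ | h5
    · exact h ⟨rfl, rfl⟩
    · omega
  · have := len_le_one n' l'; linarith

lemma Sep.symm {u v u' v' s : ℝ} (h : Sep u v u' v' s) : Sep u' v' u v s := Or.symm h

lemma pos_cases (a n : ℕ) : cc a n = root n a ∨
    (OK cc a ∧ n < a ∧ (dt a).q1 ≤ n ∧ n < (dt a).q2 ∧ cc a n = posX cc a) ∨
    (OK cc a ∧ n < a ∧ n = (dt a).q2 ∧ cc a n = posY cc a) := by
  rcases cc_spec a with ⟨hok, hx, hy, hr⟩ | ⟨_, hr⟩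
  · have q12 := hok.q12
    have q2 := hok.q2
    by_cases h1 : (dt a).q1 ≤ n ∧ n < (dt a).q2
    · exact Or.inr (Or.inl ⟨hok, by omega, h1.1, h1.2, hx n h1.1 h1.2⟩)
    · by_cases h2 : n = (dt a).q2
      · exact Or.inr (Or.inr ⟨hok, by omega, h2, by rw [h2]; exact hy⟩)
      · exact Or.inl (hr n (by omega))
  · exact Or.inl (hr n)

lemma F1 {n l l' : ℕ} (h : l < l') :
    Sep (cc l' n) (cc l' n + len n l') (cc l n) (cc l n + len n l) (sp n l) := by
  rcases pos_cases l' n with e | ⟨hok, _, h1, h2, e⟩ | ⟨hok, _, h1, e⟩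
  · rw [e]
    exact (root_sep_cc (sp_le_one n l) (by omega) (by omega)).symm
  · have := hok.sx n h1 l h (by have := hok.n1; omega)
    rw [e]
    refine this.mono le_rfl ?_
    have := len_anti l' h1
    linarith
  · have := hok.sy n h1.ge l h (by have := hok.n2; omega)
    rw [e]
    rw [← h1] at this
    exact this

section adversary

variable (α β : ℕ → ℝ)

def Touch (j n l : ℕ) : Prop := ∃ z, α j ≤ z ∧ z ≤ β j ∧ cc l n ≤ z ∧ z ≤ cc l n + len n l

def Unt (n l : ℕ) : Prop := ∀ j ≤ max l n, ¬ Touch α β j n l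

def Good (n l q : ℕ) : Prop := ∀ n', q ≤ n' → ∀ l' ≤ max l n, ¬ (n' = n ∧ l' = l) →
  Sep (cc l n) (cc l n + len n l) (cc l' n') (cc l' n' + len n' l') (sp n' l')

def Val (n l q : ℕ) : Prop := ∀ i < q, ∃ l', cc l' i ≤ cc l n ∧
  cc l n + len n l ≤ cc l' i + len i l'

structure Node (n l q : ℕ) : Prop where
  unt : Unt α β n l
  good : Good n l q
  val : Val n l q
  lt : n < q

variable {α β}

lemma touch_two (hJ : ∀ j, β j - α j ≤ lam j) {j n l l' : ℕ} (h : l < l')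
    (h1 : Touch α β j n l) (h2 : Touch α β j n l') : n < l ∧ j < l := by
  obtain ⟨z, a1, a2, a3, a4⟩ := h1
  obtain ⟨z', b1, b2, b3, b4⟩ := h2
  have hlt : sp n l < lam j := by
    have := hJ j
    rcases F1 (n := n) h with h | h <;> linarith
  by_cases hn : l ≤ n
  · have : sp n l = 1 := by simp [sp, hn]
    have := lam_le_one j
    linarith
  · rw [sp_of_lt (by omega)] at hlt
    refine ⟨by omega, ?_⟩
    by_contra hc
    have := lam_anti (show l ≤ j by omega)
    linarith

lemma lemmaU (hJ : ∀ j, β j - α j ≤ lam j) {m : ℕ} (hm : ∀ n l, ¬ Touch α β m n l) (n : ℕ) :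
    ∃ l, Unt α β n l := by
  by_contra hcon
  simp only [Unt, not_exists, not_forall, not_not] at hcon
  choose f hf hft using hcon
  have key : ∀ L, n ≤ L → ∀ j ≤ L, ∃ l ≤ L, f l = j ∧ (l ≤ n ∨ l = j) := by
    intro L hL
    induction L, hL using Nat.le_induction with
    | base =>
      have hmaps : ∀ l ∈ Finset.range (n+1), f l ∈ Finset.range (n+1) := by
        intro l hl
        have := hf l
        simp only [Finset.mem_range] at *
        omega
      have hinj : Set.InjOn f (Finset.range (n+1)) := by
        intro l hl l' hl' e
        simp only [Finset.coe_range, Set.mem_Iio] at hl hl'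
        by_contra hne
        rcases lt_or_gt_of_ne hne with h | h
        · have := touch_two hJ h (hft l) (by rw [e]; exact hft l'); omega
        · have := touch_two hJ h (hft l') (by rw [← e]; exact hft l); omega
      intro j hj
      have := Finset.surjOn_of_injOn_of_card_le f (s := Finset.range (n+1)) (t := Finset.range (n+1))
        hmaps hinj le_rfl
      obtain ⟨l, hl, e⟩ := this (by simpa using Nat.lt_succ_of_le hj : j ∈ (Finset.range (n+1) : Set ℕ))
      simp only [Finset.coe_range, Set.mem_Iio] at hl
      exact ⟨l, by omega, e, Or.inl (by omega)⟩
    | succ L hL ih =>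
      intro j hj
      by_cases hjL : j ≤ L
      · obtain ⟨l, h1, h2⟩ := ih j hjL
        exact ⟨l, by omega, h2⟩
      · refine ⟨L+1, le_rfl, ?_, Or.inr (by omega)⟩
        by_contra hne
        have h3 := hf (L+1)
        have h4 : f (L+1) ≤ L := by omega
        obtain ⟨l, h1, h2, h5⟩ := ih _ h4
        have := touch_two hJ (show l < L+1 by omega) (hft l) (by rw [h2]; exact hft (L+1))
        rw [h2] at this
        omega
  obtain ⟨l, _, h, _⟩ := key (max m n) (le_max_right _ _) m (le_max_left _ _)
  exact hm n l (h ▸ hft l)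

lemma Unt.mono {n n' l l' : ℕ} (h : Unt α β n l) (hle : max l' n' ≤ max l n)
    (h1 : cc l n ≤ cc l' n') (h2 : cc l' n' + len n' l' ≤ cc l n + len n l) : Unt α β n' l' := by
  rintro j hj ⟨z, a1, a2, a3, a4⟩
  exact h j (hj.trans hle) ⟨z, a1, a2, by linarith, by linarith⟩

lemma good_fresh {n l q : ℕ} (e : cc l n = root n l) : Good n l q := by
  intro n' _ l' hl' hne
  rw [e]
  exact (root_sep_cc (sp_le_one _ _) hne hl').symm

lemma nodeA {a : ℕ} (hok : OK cc a) (hu : Unt α β ((dt a).q2 - 1) a) :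
    ∃ q, (dt a).q2 ≤ q ∧ ((dt a).n1 = (dt a).q2 → (dt a).q2 < q) ∧ Node α β ((dt a).q2 - 1) a q := by
  have q12 := hok.q12
  have q2 := hok.q2
  have n1 := hok.n1
  obtain ⟨_, hx, hy, hr⟩ | ⟨h, _⟩ := cc_spec a
  swap
  · exact absurd hok h
  have e : cc a ((dt a).q2 - 1) = posX cc a := hx _ (by omega) (by omega)
  have hlen := len_anti a (show (dt a).q1 ≤ (dt a).q2 - 1 by omega)
  obtain ⟨q, hq1, hq2, hq3, hq4⟩ : ∃ q, (dt a).q2 ≤ q ∧ ((dt a).n1 = (dt a).q2 → (dt a).q2 < q) ∧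
      ((dt a).n1 < (dt a).q1 → q = (dt a).q2) ∧ ((dt a).n1 = (dt a).q2 → q = (dt a).q2 + 1) := by
    by_cases h : (dt a).n1 = (dt a).q2
    · exact ⟨(dt a).q2 + 1, by omega, by omega, by omega, by omega⟩
    · exact ⟨(dt a).q2, by omega, by omega, by omega, by omega⟩
  refine ⟨q, hq1, hq2, hu, ?_, ?_, by omega⟩
  · intro n' hn' l' hl' hne
    rcases lt_or_eq_of_le (show l' ≤ a by omega) with h | rfl
    · rw [e]
      exact (hok.sx n' (by omega) l' h (by omega)).mono le_rfl (by linarith)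
    · rcases lt_or_eq_of_le (show (dt l').q2 ≤ n' by omega) with h | rfl
      · rw [hr n' (Or.inr h)]
        exact root_sep_cc (sp_le_one _ _) (by omega) (by omega)
      · rw [e, hy, sp_of_lt (by omega)]
        exact hok.sxy.mono le_rfl (by linarith)
  · intro i hi
    by_cases h : i < (dt a).q1
    · obtain ⟨l, _, h1, h2⟩ := hok.v1 i h
      have := hok.x1
      have := hok.x2
      exact ⟨l, by linarith, by linarith⟩
    · by_cases h2 : i < (dt a).q2
      · have := hx i (by omega) h2
        have := len_anti a (show i ≤ (dt a).q2 - 1 by omega)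
        exact ⟨a, by linarith, by linarith⟩
      · have h3 : i = (dt a).n1 := by omega
        have := hok.x1
        have := hok.x2
        refine ⟨(dt a).l1, ?_, ?_⟩
        · rw [h3]; linarith
        · rw [h3]; linarith

lemma nodeB {a : ℕ} (hok : OK cc a) (hu : Unt α β (dt a).q2 a) :
    Node α β (dt a).q2 a ((dt a).q2 + 1) := by
  have q12 := hok.q12
  have q2 := hok.q2
  have n2 := hok.n2
  obtain ⟨_, hx, hy, hr⟩ | ⟨h, _⟩ := cc_spec a
  swap
  · exact absurd hok h
  refine ⟨hu, ?_, ?_, by omega⟩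
  · intro n' hn' l' hl' hne
    rcases lt_or_eq_of_le (show l' ≤ a by omega) with h | rfl
    · rw [hy]
      exact (hok.sy n' (by omega) l' h (by omega))
    · rw [hr n' (Or.inr (by omega))]
      exact root_sep_cc (sp_le_one _ _) (by omega) (by omega)
  · intro i hi
    rcases lt_or_eq_of_le (show i ≤ (dt a).q2 by omega) with h | rfl
    · obtain ⟨l, _, h1, h2⟩ := hok.v2 i h
      have := hok.y1
      have := hok.y2
      exact ⟨l, by linarith, by linarith⟩
    · exact ⟨a, le_rfl, le_rfl⟩

lemma count_one {h : ℝ} (hh : 0 < h) (b u μ : ℝ) (hμ : 0 ≤ μ) (N : ℕ) :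
    (((Finset.range N).filter (fun i : ℕ => u ≤ b + i * h ∧ b + i * h ≤ u + μ)).card : ℝ) ≤ 1 + μ / h := by
  set A := (Finset.range N).filter (fun i : ℕ => u ≤ b + i * h ∧ b + i * h ≤ u + μ) with hA
  rcases A.eq_empty_or_nonempty with h0 | h0
  · rw [h0]; simp; positivity
  · have hsub : A ⊆ Finset.Icc (A.min' h0) (A.max' h0) := fun i hi =>
      Finset.mem_Icc.2 ⟨A.min'_le i hi, A.le_max' i hi⟩
    have h1 := Finset.card_le_card hsub
    rw [Nat.card_Icc] at h1
    have h2 := A.min'_mem h0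
    have h3 := A.max'_mem h0
    have h4 : A.min' h0 ≤ A.max' h0 := A.min'_le _ h3
    set i := A.min' h0
    set j := A.max' h0
    rw [hA, Finset.mem_filter] at h2 h3
    have h5 : (A.card : ℝ) + i ≤ j + 1 := by
      have : A.card + i ≤ j + 1 := by omega
      exact_mod_cast this
    have h6 : ((j : ℝ) - i) * h ≤ μ := by nlinarith [h2.2.1, h3.2.2]
    have h7 : (j : ℝ) - i ≤ μ / h := by rwa [le_div_iff₀ hh]
    linarith

lemma CL {ι : Type*} (F : Finset ι) {h : ℝ} (hh : 0 < h) (b : ℝ) (u μ : ι → ℝ)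
    (hμ : ∀ j ∈ F, 0 ≤ μ j) (S : Finset ℕ)
    (hS : ∀ i ∈ S, ∃ j ∈ F, u j ≤ b + i * h ∧ b + i * h ≤ u j + μ j) :
    (S.card : ℝ) ≤ F.card + (∑ j ∈ F, μ j) / h := by
  classical
  obtain ⟨N, hN⟩ := S.exists_nat_subset_range
  have hsub : S ⊆ F.biUnion (fun j => (Finset.range N).filter
      (fun i : ℕ => u j ≤ b + i * h ∧ b + i * h ≤ u j + μ j)) := by
    intro i hi
    obtain ⟨j, hj, hj2⟩ := hS i hi
    exact Finset.mem_biUnion.2 ⟨j, hj, Finset.mem_filter.2 ⟨hN hi, hj2⟩⟩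
  have h1 := (Finset.card_le_card hsub).trans Finset.card_biUnion_le
  have h2 : (S.card : ℝ) ≤ ∑ j ∈ F, (((Finset.range N).filter
      (fun i : ℕ => u j ≤ b + i * h ∧ b + i * h ≤ u j + μ j)).card : ℝ) := by exact_mod_cast h1
  refine h2.trans ((Finset.sum_le_sum fun j hj => count_one hh b (u j) (μ j) (hμ j hj) N).trans ?_)
  rw [Finset.sum_add_distrib, Finset.sum_div]
  simp

lemma lam_sum_gt {n l : ℕ} (t : ℕ) (F : Finset ℕ) (hF : F ⊆ Finset.Ioo (max l n) t) :
    ∑ j ∈ F, lam j ≤ 2 * (dl * len n l) := by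
  have h1 : ∑ j ∈ F, lam j ≤ ∑ j ∈ Finset.Ico (max l n + 1) t, lam j := by
    apply Finset.sum_le_sum_of_subset_of_nonneg
    · intro j hj
      have := Finset.mem_Ioo.1 (hF hj)
      exact Finset.mem_Ico.2 ⟨by omega, this.2⟩
    · intro j _ _; exact (lam_pos j).le
  have := lam_sum (max l n + 1) t
  have := lam_key n l
  linarith

lemma side1 {n0 l0 q0 t : ℕ} (ht : 0 < t) {b h w : ℝ} (hh : h = len n0 l0 / (297 * t))
    (hw : w = lam t) (hwh : 100 * w ≤ h) (hb : cc l0 n0 ≤ b)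
    (hb2 : b + len n0 l0 / 3 ≤ cc l0 n0 + len n0 l0) (hg : Good n0 l0 q0)
    (p p' : ℕ → ℝ) (hp : ∀ l n, l < 100 * t → cc l n = root n l ∨ (n < l ∧ (cc l n = p l ∨ cc l n = p' l)))
    (hp1 : ∀ l, t ≤ l → l < 100 * t → p l = b + ((l - t : ℕ) : ℝ) * h)
    (hp2 : ∀ l, t ≤ l → l < 100 * t → b + len n0 l0 / 3 + 3 * w ≤ p' l ∨ p' l + 3 * w ≤ b) :
    ∃ B : Finset ℕ, B.card ≤ 3 * t ∧ ∀ i < 99 * t, i ∉ B → ∀ n, q0 ≤ n → ∀ l < t + i,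
      ¬ (n = n0 ∧ l = l0) → Sep (b + i * h) (b + i * h + w) (cc l n) (cc l n + len n l) (sp n l) := by
  classical
  have htR : (0 : ℝ) < t := by exact_mod_cast ht
  have hκ := len_pos n0 l0
  have hhpos : 0 < h := by rw [hh]; positivity
  have hht : h * (297 * t) = len n0 l0 := by rw [hh]; field_simp
  have hwpos : 0 < w := by rw [hw]; exact lam_pos t
  have hin : ∀ i < 99 * t, b + i * h + h ≤ b + len n0 l0 / 3 := by
    intro i hi
    have : (i : ℝ) + 1 ≤ 99 * t := by exact_mod_cast hi
    nlinarith
  let F := (Finset.Ioo (max l0 n0) t) ×ˢ (Finset.univ : Finset Bool)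
  let u : ℕ × Bool → ℝ := fun x => (if x.2 then p x.1 else p' x.1) - 3 * lam x.1
  let μ : ℕ × Bool → ℝ := fun x => 6 * lam x.1
  refine ⟨(Finset.range (99 * t)).filter (fun i : ℕ => ∃ x ∈ F, u x ≤ b + i * h ∧ b + i * h ≤ u x + μ x),
    ?_, ?_⟩
  · have := CL F hhpos b u μ (fun x _ => by have := lam_pos x.1; simp only [μ]; linarith)
      ((Finset.range (99 * t)).filter (fun i : ℕ => ∃ x ∈ F, u x ≤ b + i * h ∧ b + i * h ≤ u x + μ x))
      (fun i hi => (Finset.mem_filter.1 hi).2)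
    have hs : ∑ x ∈ F, μ x = 12 * ∑ j ∈ Finset.Ioo (max l0 n0) t, lam j := by
      simp only [F, μ, Finset.sum_product, Finset.sum_const, Finset.mul_sum]
      apply Finset.sum_congr rfl
      intro j _
      simp; ring
    have h3 := lam_sum_gt (n := n0) (l := l0) t _ (Finset.Subset.refl _)
    have h4 : (∑ x ∈ F, μ x) / h ≤ t := by
      rw [div_le_iff₀ hhpos, hs]
      have : dl = 1 / 10000 := rfl
      rw [this] at h3
      nlinarith
    have h5 : (F.card : ℝ) ≤ 2 * t := by
      have : F.card ≤ 2 * t := by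
        simp only [F, Finset.card_product, Nat.card_Ioo]
        simp; omega
      exact_mod_cast this
    have h6 : (((Finset.range (99 * t)).filter (fun i : ℕ => ∃ x ∈ F, u x ≤ b + i * h ∧
      b + i * h ≤ u x + μ x)).card : ℝ) ≤ 3 * t := by linarith
    exact_mod_cast h6
  · intro i hi hiB n hn l hl hne
    have hi1 := hin i hi
    have hi0 : 0 ≤ (i : ℝ) * h := by positivity
    by_cases hlM : l ≤ max l0 n0
    · exact (hg n hn l hlM hne).mono (by linarith) (by linarith)
    · rcases hp l n (by omega) with e | ⟨hnl, e⟩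
      · rw [e]
        exact (root_sep_cc (n := n0) (a := l0) (sp_le_one n l) (by omega) (by omega)).mono (by linarith) (by linarith)
      · rw [sp_of_lt hnl]
        have hll := len_le_lam n l
        have hl0 := len_pos n l
        by_cases hlt : l < t
        · by_contra hcon
          apply hiB
          simp only [Sep, not_or, not_lt] at hcon
          have hwl : w ≤ lam l := by rw [hw]; exact lam_anti hlt.le
          have hlF : l ∈ Finset.Ioo (max l0 n0) t := Finset.mem_Ioo.2 ⟨by omega, hlt⟩
          refine Finset.mem_filter.2 ⟨Finset.mem_range.2 hi, ?_⟩
          rcases e with e | e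
          · refine ⟨(l, true), Finset.mem_product.2 ⟨hlF, Finset.mem_univ _⟩, ?_, ?_⟩ <;>
            simp only [u, μ, if_true] <;> rw [← e] <;> linarith [hcon.1, hcon.2]
          · refine ⟨(l, false), Finset.mem_product.2 ⟨hlF, Finset.mem_univ _⟩, ?_, ?_⟩ <;>
            simp only [u, μ] <;> simp only [Bool.false_eq_true, if_false] <;> rw [← e] <;>
            linarith [hcon.1, hcon.2]
        · have hwl : lam l ≤ w := by rw [hw]; exact lam_anti (by omega)
          rcases e with e | e
          · rw [hp1 l (by omega) (by omega)] at e
            right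
            rw [e]
            have : ((l - t : ℕ) : ℝ) + 1 ≤ i := by
              have : (l - t) + 1 ≤ i := by omega
              exact_mod_cast this
            nlinarith
          · rcases hp2 l (by omega) (by omega) with h1 | h1
            · left; rw [e]; linarith
            · right; rw [e]; linarith

lemma side2 {α β : ℕ → ℝ} (hJ : ∀ j, β j - α j ≤ lam j) {n0 l0 t : ℕ} (ht : 0 < t) {b h w : ℝ}
    (hh : h = len n0 l0 / (297 * t))
    (hw : w = lam t) (hwh : 100 * w ≤ h) (hb : cc l0 n0 ≤ b)
    (hb2 : b + len n0 l0 / 3 ≤ cc l0 n0 + len n0 l0) (hu : Unt α β n0 l0) (JX : Finset ℕ)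
    (hJX : ∀ j ∈ JX, j < 100 * t ∧ ∃ z, α j ≤ z ∧ z ≤ β j ∧ b ≤ z ∧ z ≤ b + len n0 l0 / 3)
    (S : Finset ℕ)
    (hS : ∀ i ∈ S, ∃ j ∈ JX, ∃ z, α j ≤ z ∧ z ≤ β j ∧ b + i * h ≤ z ∧ z ≤ b + i * h + w) :
    S.card ≤ JX.card + 2 * t := by
  have htR : (0 : ℝ) < t := by exact_mod_cast ht
  have hκ := len_pos n0 l0
  have hhpos : 0 < h := by rw [hh]; positivity
  have hht : h * (297 * t) = len n0 l0 := by rw [hh]; field_simp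
  have hwpos : 0 < w := by rw [hw]; exact lam_pos t
  have := CL JX hhpos b (fun j => α j - w) (fun j => lam j + w)
    (fun j _ => by have := lam_pos j; linarith) S (by
      intro i hi
      obtain ⟨j, hj, z, h1, h2, h3, h4⟩ := hS i hi
      have := hJ j
      exact ⟨j, hj, by linarith, by linarith⟩)
  have hsub : JX ⊆ Finset.Ioo (max l0 n0) (100 * t) := by
    intro j hj
    obtain ⟨h0, z, h1, h2, h3, h4⟩ := hJX j hj
    refine Finset.mem_Ioo.2 ⟨?_, h0⟩
    by_contra hc
    exact hu j (by omega) ⟨z, h1, h2, by linarith, by linarith⟩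
  have h3 := lam_sum_gt (n := n0) (l := l0) _ JX hsub
  have hcard : (JX.card : ℝ) ≤ 100 * t := by
    have : JX.card ≤ (Finset.range (100 * t)).card :=
      Finset.card_le_card fun j hj => Finset.mem_range.2 (hJX j hj).1
    rw [Finset.card_range] at this
    exact_mod_cast this
  have h4 : (∑ j ∈ JX, (lam j + w)) / h ≤ 2 * t := by
    rw [div_le_iff₀ hhpos, Finset.sum_add_distrib, Finset.sum_const, nsmul_eq_mul]
    have : dl = 1 / 10000 := rfl
    rw [this] at h3
    nlinarith
  have h5 : (S.card : ℝ) ≤ JX.card + 2 * t := by linarith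
  exact_mod_cast h5

lemma gap (k κ k' κ' : ℝ) :
    bX k κ k' κ' + κ / 3 + (κ + κ') / 6 ≤ bY k κ k' κ' ∨
    bY k κ k' κ' + κ' / 3 + (κ + κ') / 6 ≤ bX k κ k' κ' := by
  unfold bX bY
  split_ifs with h
  · left; linarith
  · right; linarith

lemma bX_mem (k κ k' κ' : ℝ) (h : 0 < κ) : k ≤ bX k κ k' κ' ∧ bX k κ k' κ' + κ / 3 ≤ k + κ := by
  unfold bX
  split_ifs <;> constructor <;> linarith

lemma bY_mem (k κ k' κ' : ℝ) (h : 0 < κ') : k' ≤ bY k κ k' κ' ∧ bY k κ k' κ' + κ' / 3 ≤ k' + κ' := by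
  unfold bY
  split_ifs <;> constructor <;> linarith

open Filter Topology in
lemma large (κ : ℝ) (hκ : 0 < κ) : ∀ᶠ t : ℕ in atTop, 29700 * (t * lam t) ≤ κ := by
  have h1 : Tendsto (fun t : ℕ => 29700 * ((t : ℝ) * dl ^ t)) atTop (𝓝 (29700 * 0)) :=
    (tendsto_self_mul_const_pow_of_lt_one dl_pos.le (by norm_num [dl])).const_mul _
  rw [mul_zero] at h1
  filter_upwards [h1.eventually (gt_mem_nhds hκ)] with t ht
  have := mul_le_mul_of_nonneg_left (lam_le_pow t) (Nat.cast_nonneg (α := ℝ) t)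
  linarith

lemma val_bound {n l q : ℕ} (h : Val n l q) : ∃ N, ∀ i < q, ∃ l' < N, cc l' i ≤ cc l n ∧
    cc l n + len n l ≤ cc l' i + len i l' := by
  choose f hf using h
  refine ⟨(Finset.range q).sup (fun i => if hi : i < q then f i hi else 0) + 1, fun i hi => ⟨f i hi, ?_, hf i hi⟩⟩
  have := Finset.le_sup (f := fun i => if hi : i < q then f i hi else 0) (Finset.mem_range.2 hi)
  simp only [hi, dite_true] at this
  omega

lemma step {α β : ℕ → ℝ} (hJ : ∀ j, β j - α j ≤ lam j) {n1 l1 q1 n2 l2 q2 : ℕ} (q12 : q1 < q2)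
    (hn2 : n2 < q2) (hn1 : n1 < q1 ∨ n1 = q2)
    (u1 : Unt α β n1 l1) (g1 : Good n1 l1 q1) (v1 : Val n1 l1 q1)
    (u2 : Unt α β n2 l2) (g2 : Good n2 l2 q2) (v2 : Val n2 l2 q2) :
    ∃ a, OK cc a ∧ dt a = ⟨n1, l1, q1, n2, l2, q2⟩ ∧
      ((∀ j ≤ a, ¬ Touch α β j q1 a) ∨ (∀ j ≤ a, ¬ Touch α β j q2 a)) := by
  classical
  obtain ⟨code, hcode⟩ := D_surj ⟨n1, l1, q1, n2, l2, q2⟩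
  obtain ⟨N1, hN1⟩ := val_bound v1
  obtain ⟨N2, hN2⟩ := val_bound v2
  set κ := len n1 l1 with hκd
  set κ' := len n2 l2 with hκd'
  have hκ : 0 < κ := len_pos _ _
  have hκ' : 0 < κ' := len_pos _ _
  have hκ1 : κ ≤ 1 := len_le_one _ _
  obtain ⟨N3, hN3⟩ := Filter.eventually_atTop.1
    ((large κ hκ).and ((large κ' hκ')))
  set r := Nat.pair code (N1 + N2 + N3 + l1 + l2 + q2 + 1) with hr
  set t : ℕ := 100 ^ r with ht
  have htbig : N1 + N2 + N3 + l1 + l2 + q2 + 1 < t :=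
    lt_of_le_of_lt (Nat.right_le_pair _ _) (Nat.lt_pow_self (by norm_num))
  have htpos : 0 < t := by omega
  have htR : (1 : ℝ) ≤ t := by exact_mod_cast htpos
  obtain ⟨L1, L2⟩ := hN3 t (by omega)
  have hlog : ∀ a, t ≤ a → a < 100 * t → Nat.log 100 a = r := by
    intro a h1 h2
    apply Nat.log_eq_of_pow_le_of_lt_pow h1
    rw [pow_succ]; omega
  have htt : ∀ a, t ≤ a → a < 100 * t → tt a = t := by
    intro a h1 h2; rw [tt, hlog a h1 h2]
  have hdt : ∀ a, t ≤ a → a < 100 * t → dt a = ⟨n1, l1, q1, n2, l2, q2⟩ := by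
    intro a h1 h2; rw [dt, hlog a h1 h2, hr, Nat.unpair_pair]; exact hcode
  set w := lam t with hw
  have hwpos : 0 < w := lam_pos t
  set b := bX (cc l1 n1) κ (cc l2 n2) κ' with hb
  set b' := bY (cc l1 n1) κ (cc l2 n2) κ' with hb'
  set h := κ / (297 * (t : ℝ)) with hh
  set h' := κ' / (297 * (t : ℝ)) with hh'
  have hX : ∀ a, t ≤ a → a < 100 * t → posX cc a = b + ((a - t : ℕ) : ℝ) * h := by
    intro a h1 h2
    simp only [posX, hdt a h1 h2, htt a h1 h2]
    rfl
  have hY : ∀ a, t ≤ a → a < 100 * t → posY cc a = b' + ((a - t : ℕ) : ℝ) * h' := by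
    intro a h1 h2
    simp only [posY, hdt a h1 h2, htt a h1 h2]
    rfl
  have hwh : 100 * w ≤ h := by
    rw [hh, le_div_iff₀ (by positivity)]; linarith
  have hwh' : 100 * w ≤ h' := by
    rw [hh', le_div_iff₀ (by positivity)]; linarith
  have hhpos : 0 < h := by linarith
  have hhpos' : 0 < h' := by linarith
  have hht : h * (297 * t) = κ := by rw [hh]; field_simp
  have hht' : h' * (297 * t) = κ' := by rw [hh']; field_simp
  have hwκ : 29700 * w ≤ κ := by nlinarith
  have hwκ' : 29700 * w ≤ κ' := by nlinarith
  obtain ⟨hb1, hb2⟩ := bX_mem (cc l1 n1) κ (cc l2 n2) κ' hκ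
  obtain ⟨hb1', hb2'⟩ := bY_mem (cc l1 n1) κ (cc l2 n2) κ' hκ'
  have hgap := gap (cc l1 n1) κ (cc l2 n2) κ'
  rw [← hb] at hb1 hb2 hgap
  rw [← hb'] at hb1' hb2' hgap
  have hin : ∀ i < 99 * t, b + i * h + h ≤ b + κ / 3 := by
    intro i hi
    have : (i : ℝ) + 1 ≤ 99 * t := by exact_mod_cast hi
    nlinarith
  have hin' : ∀ i < 99 * t, b' + i * h' + h' ≤ b' + κ' / 3 := by
    intro i hi
    have : (i : ℝ) + 1 ≤ 99 * t := by exact_mod_cast hi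
    nlinarith
  have hin0 : ∀ i : ℕ, 0 ≤ (i : ℝ) * h := fun i => by positivity
  have hin0' : ∀ i : ℕ, 0 ≤ (i : ℝ) * h' := fun i => by positivity
  have hcast : ∀ i : ℕ, t + i - t = i := fun i => by omega
  obtain ⟨B, hB, hB2⟩ := side1 (n0 := n1) (l0 := l1) (q0 := q1) htpos hh hw hwh hb1 hb2 g1
    (posX cc) (posY cc) (by
      intro l n _
      rcases pos_cases l n with e | e | e
      · exact Or.inl e
      · exact Or.inr ⟨e.2.1, Or.inl e.2.2.2.2⟩
      · exact Or.inr ⟨e.2.1, Or.inr e.2.2.2⟩) hX (by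
      intro l h1 h2
      rw [hY l h1 h2]
      have := hin' (l - t) (by omega)
      have := hin0' (l - t)
      rcases hgap with hg | hg
      · left; linarith
      · right; linarith)
  obtain ⟨B', hB', hB2'⟩ := side1 (n0 := n2) (l0 := l2) (q0 := q2) htpos hh' hw hwh' hb1' hb2' g2
    (posY cc) (posX cc) (by
      intro l n _
      rcases pos_cases l n with e | e | e
      · exact Or.inl e
      · exact Or.inr ⟨e.2.1, Or.inr e.2.2.2.2⟩
      · exact Or.inr ⟨e.2.1, Or.inl e.2.2.2⟩) hY (by
      intro l h1 h2
      rw [hX l h1 h2]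
      have := hin (l - t) (by omega)
      have := hin0 (l - t)
      rcases hgap with hg | hg
      · right; linarith
      · left; linarith)
  have hlw : ∀ q i, len q (t + i) ≤ w := fun q i =>
    (len_le_lam _ _).trans (lam_anti (by omega))
  set S := Finset.range (99 * t) \ (B ∪ B') with hS
  have hScard : 93 * t ≤ S.card := by
    have h1 : (Finset.range (99 * t)).card - (B ∪ B').card ≤ S.card := Finset.le_card_sdiff _ _
    have h2 := Finset.card_union_le B B'
    rw [Finset.card_range] at h1
    omega
  have hSm : ∀ i ∈ S, i < 99 * t ∧ i ∉ B ∧ i ∉ B' := by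
    intro i hi
    simp only [hS, Finset.mem_sdiff, Finset.mem_range, Finset.mem_union, not_or] at hi
    exact hi
  have hOK : ∀ i ∈ S, OK cc (t + i) := by
    intro i hi
    obtain ⟨hi1, hi2, hi3⟩ := hSm i hi
    have d := hdt (t + i) (by omega) (by omega)
    have pX := hX (t + i) (by omega) (by omega)
    have pY := hY (t + i) (by omega) (by omega)
    rw [hcast] at pX pY
    have i1 := hin i hi1
    have i2 := hin' i hi1
    have i3 := hin0 i
    have i4 := hin0' i
    have w1 := hlw q1 i
    have w2 := hlw q2 i
    refine ⟨?_, ?_, ?_, ?_, ?_, ?_, ?_, ?_, ?_, ?_, ?_, ?_, ?_, ?_, ?_⟩ <;>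
      simp only [d, pX, pY] <;> try omega
    · linarith
    · linarith
    · linarith
    · linarith
    · intro j hj
      obtain ⟨l', h1, h2⟩ := hN1 j hj
      exact ⟨l', by omega, h2⟩
    · intro j hj
      obtain ⟨l', h1, h2⟩ := hN2 j hj
      exact ⟨l', by omega, h2⟩
    · intro n hn l hl hne
      exact (hB2 i hi1 hi2 n hn l hl hne).mono le_rfl (by linarith)
    · intro n hn l hl hne
      exact (hB2' i hi1 hi3 n hn l hl hne).mono le_rfl (by linarith)
    · have : lam (t + i) ≤ w := lam_anti (by omega)
      rcases hgap with hg | hg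
      · left; linarith
      · right; linarith
  by_contra hcon
  push Not at hcon
  have htouch : ∀ i ∈ S, (∃ j < 100 * t, ∃ z, α j ≤ z ∧ z ≤ β j ∧ b + i * h ≤ z ∧ z ≤ b + i * h + w) ∧
      (∃ j < 100 * t, ∃ z, α j ≤ z ∧ z ≤ β j ∧ b' + i * h' ≤ z ∧ z ≤ b' + i * h' + w) := by
    intro i hi
    obtain ⟨hi1, hi2, hi3⟩ := hSm i hi
    have d := hdt (t + i) (by omega) (by omega)
    have pX := hX (t + i) (by omega) (by omega)
    have pY := hY (t + i) (by omega) (by omega)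
    rw [hcast] at pX pY
    have w1 := hlw q1 i
    have w2 := hlw q2 i
    obtain ⟨⟨j, hj, z, z1, z2, z3, z4⟩, ⟨j', hj', z', z1', z2', z3', z4'⟩⟩ := hcon (t + i) (hOK i hi) d
    rcases cc_spec (t + i) with ⟨_, c1, c2, _⟩ | ⟨c0, _⟩
    · rw [d] at c1 c2
      have c1 := c1 q1 le_rfl q12
      simp only at c2
      rw [c1, pX] at z3 z4
      rw [c2, pY] at z3' z4'
      exact ⟨⟨j, by omega, z, z1, z2, z3, by linarith⟩, ⟨j', by omega, z', z1', z2', z3', by linarith⟩⟩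
    · exact absurd (hOK i hi) c0
  set JX := (Finset.range (100 * t)).filter
    (fun j => ∃ z, α j ≤ z ∧ z ≤ β j ∧ b ≤ z ∧ z ≤ b + κ / 3) with hJXd
  set JY := (Finset.range (100 * t)).filter
    (fun j => ∃ z, α j ≤ z ∧ z ≤ β j ∧ b' ≤ z ∧ z ≤ b' + κ' / 3) with hJYd
  have k1 := side2 hJ htpos hh hw hwh hb1 hb2 u1 JX (by
    intro j hj
    have := Finset.mem_filter.1 hj
    exact ⟨Finset.mem_range.1 this.1, this.2⟩) S (by
    intro i hi
    obtain ⟨⟨j, hj, z, z1, z2, z3, z4⟩, _⟩ := htouch i hi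
    have := hin i (hSm i hi).1
    have := hin0 i
    exact ⟨j, Finset.mem_filter.2 ⟨Finset.mem_range.2 hj, z, z1, z2, by linarith, by linarith⟩,
      z, z1, z2, z3, z4⟩)
  have k2 := side2 hJ htpos hh' hw hwh' hb1' hb2' u2 JY (by
    intro j hj
    have := Finset.mem_filter.1 hj
    exact ⟨Finset.mem_range.1 this.1, this.2⟩) S (by
    intro i hi
    obtain ⟨_, ⟨j, hj, z, z1, z2, z3, z4⟩⟩ := htouch i hi
    have := hin' i (hSm i hi).1
    have := hin0' i
    exact ⟨j, Finset.mem_filter.2 ⟨Finset.mem_range.2 hj, z, z1, z2, by linarith, by linarith⟩,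
      z, z1, z2, z3, z4⟩)
  have k3 : (JX ∪ JY).card ≤ 100 * t := by
    have : JX ∪ JY ⊆ Finset.range (100 * t) :=
      Finset.union_subset (Finset.filter_subset _ _) (Finset.filter_subset _ _)
    simpa using Finset.card_le_card this
  have k4 : (JX ∩ JY).card ≤ t := by
    have : JX ∩ JY ⊆ Finset.range t := by
      intro j hj
      obtain ⟨h1, h2⟩ := Finset.mem_inter.1 hj
      obtain ⟨_, z, z1, z2, z3, z4⟩ := Finset.mem_filter.1 h1
      obtain ⟨_, z', z1', z2', z3', z4'⟩ := Finset.mem_filter.1 h2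
      rw [Finset.mem_range]
      by_contra hc
      have e1 : lam j ≤ w := lam_anti (by omega)
      have e2 := hJ j
      rcases hgap with hg | hg <;> linarith
    simpa using Finset.card_le_card this
  have k5 := Finset.card_union_add_card_inter JX JY
  omega

def XX : Set ℝ := {z | ∀ n, ∃ l, cc l n ≤ z ∧ z ≤ cc l n + len n l}

def Loser (α β : ℕ → ℝ) (n l q : ℕ) : Prop := ∀ n' a q', l < a → q < q' → cc l n ≤ cc a n' →
  cc a n' + len n' a ≤ cc l n + len n l → ¬ Node α β n' a q'

lemma descent {α β : ℕ → ℝ} (hc : ∀ z ∈ XX, ∃ j, α j ≤ z ∧ z ≤ β j) {n l q : ℕ}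
    (h : Node α β n l q) : ∃ n' l' q', q ≤ q' ∧ Node α β n' l' q' ∧ Loser α β n' l' q' := by
  by_contra hcon
  push Not at hcon
  let T := {x : ℕ × ℕ × ℕ // q ≤ x.2.2 ∧ Node α β x.1 x.2.1 x.2.2}
  have hnext : ∀ x : T, ∃ y : T, x.1.2.1 < y.1.2.1 ∧ x.1.2.2 < y.1.2.2 ∧
      cc x.1.2.1 x.1.1 ≤ cc y.1.2.1 y.1.1 ∧
      cc y.1.2.1 y.1.1 + len y.1.1 y.1.2.1 ≤ cc x.1.2.1 x.1.1 + len x.1.1 x.1.2.1 := by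
    rintro ⟨⟨n', l', q'⟩, hq, hN⟩
    have := hcon n' l' q' hq hN
    unfold Loser at this
    push Not at this
    obtain ⟨n'', a, q'', h1, h2, h3, h4, h5⟩ := this
    exact ⟨⟨⟨n'', a, q''⟩, le_trans hq h2.le, h5⟩, h1, h2, h3, h4⟩
  choose nx hnx using hnext
  let s : ℕ → T := fun k => Nat.rec ⟨⟨n, l, q⟩, le_rfl, h⟩ (fun _ x => nx x) k
  have hs : ∀ k, s (k + 1) = nx (s k) := fun k => rfl
  let A : ℕ → ℝ := fun k => cc (s k).1.2.1 (s k).1.1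
  let E : ℕ → ℝ := fun k => cc (s k).1.2.1 (s k).1.1 + len (s k).1.1 (s k).1.2.1
  have hA : Monotone A := monotone_nat_of_le_succ fun k => by
    simp only [A]; rw [hs k]; exact (hnx (s k)).2.2.1
  have hE : Antitone E := antitone_nat_of_succ_le fun k => by
    simp only [E]; rw [hs k]; exact (hnx (s k)).2.2.2
  have hl : StrictMono fun k => (s k).1.2.1 := strictMono_nat_of_lt_succ fun k => by
    rw [hs k]; exact (hnx (s k)).1
  have hq : StrictMono fun k => (s k).1.2.2 := strictMono_nat_of_lt_succ fun k => by
    rw [hs k]; exact (hnx (s k)).2.1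
  have hz := hA.ciSup_mem_iInter_Icc_of_antitone hE (fun k => by
    simp only [A, E]; have := len_pos (s k).1.1 (s k).1.2.1; linarith)
  set z := ⨆ k, A k
  have hz : ∀ k, A k ≤ z ∧ z ≤ E k := fun k => Set.mem_iInter.1 hz k
  have hzX : z ∈ XX := by
    intro i
    have h1 : i + 1 ≤ (s (i + 1)).1.2.2 := hq.le_apply
    obtain ⟨l', h2, h3⟩ := (s (i + 1)).2.2.val i (by omega)
    obtain ⟨h4, h5⟩ := hz (i + 1)
    exact ⟨l', h2.trans h4, h5.trans h3⟩
  obtain ⟨j, h1, h2⟩ := hc z hzX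
  have h3 : j ≤ (s j).1.2.1 := hl.le_apply
  exact (s j).2.2.unt j (h3.trans (le_max_left _ _)) ⟨z, h1, h2, (hz j).1, (hz j).2⟩

lemma nonfresh {α β : ℕ → ℝ} {n l : ℕ} (hu : Unt α β n l) (hf : cc l n ≠ root n l) :
    ∃ n' l' q', n < q' ∧ Node α β n' l' q' := by
  rcases pos_cases l n with e | ⟨hok, h1, h2, h3, e⟩ | ⟨hok, h1, h2, e⟩
  · exact absurd e hf
  · have q2 := hok.q2
    have q12 := hok.q12
    have hu' : Unt α β ((dt l).q2 - 1) l := by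
      rcases cc_spec l with ⟨_, c1, _, _⟩ | ⟨c, _⟩
      · have e2 := c1 ((dt l).q2 - 1) (by omega) (by omega)
        have := len_anti l (show n ≤ (dt l).q2 - 1 by omega)
        refine hu.mono (by omega) (by rw [e, e2]) (by rw [e, e2]; linarith)
      · exact absurd hok c
    obtain ⟨q, hq, _, hN⟩ := nodeA hok hu'
    exact ⟨_, _, q, by omega, hN⟩
  · rw [h2] at hu
    exact ⟨_, _, _, by omega, nodeB hok hu⟩

lemma step_out {α β : ℕ → ℝ} (hJ : ∀ j, β j - α j ≤ lam j) {n1 l1 q1 n2 l2 q2 : ℕ} (q12 : q1 < q2)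
    (hn2 : n2 < q2) (hn1 : n1 < q1 ∨ n1 = q2)
    (u1 : Unt α β n1 l1) (g1 : Good n1 l1 q1) (v1 : Val n1 l1 q1)
    (u2 : Unt α β n2 l2) (g2 : Good n2 l2 q2) (v2 : Val n2 l2 q2) (hL : Loser α β n2 l2 q2) :
    ∃ n a q, l1 < a ∧ q2 ≤ q ∧ (n1 = q2 → q2 < q) ∧ cc l1 n1 ≤ cc a n ∧
      cc a n + len n a ≤ cc l1 n1 + len n1 l1 ∧ Node α β n a q := by
  obtain ⟨a, hok, d, hor⟩ := step hJ q12 hn2 hn1 u1 g1 v1 u2 g2 v2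
  have hq2 := hok.q2
  have hl1 := hok.l1
  have hl2 := hok.l2
  have x1 := hok.x1
  have x2 := hok.x2
  have y1 := hok.y1
  have y2 := hok.y2
  rcases cc_spec a with ⟨_, c1, c2, _⟩ | ⟨c, _⟩
  swap
  · exact absurd hok c
  rcases hor with ht | ht
  · have hu : Unt α β q1 a := by
      intro j hj
      simp only [d] at hq2
      exact ht j (by omega)
    have e1 := c1 q1 (by rw [d]) (by rw [d]; exact q12)
    have e2 := c1 (q2 - 1) (by rw [d]; simp only; omega) (by rw [d]; simp only; omega)
    have hlen := len_anti a (show q1 ≤ q2 - 1 by omega)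
    have hu' : Unt α β ((dt a).q2 - 1) a := by
      rw [d]
      simp only [d] at hq2
      refine hu.mono (by simp only; omega) (by simp only; rw [e1, e2]) ?_
      simp only
      rw [e1, e2]; linarith
    obtain ⟨q, h1, h2, hN⟩ := nodeA hok hu'
    simp only [d] at *
    refine ⟨_, a, q, hl1, h1, h2, ?_, ?_, hN⟩
    · rw [e2]; exact x1
    · rw [e2]; linarith
  · exfalso
    have hu : Unt α β (dt a).q2 a := by
      intro j hj
      rw [d] at hj ⊢
      simp only [d] at hq2
      exact ht j (by simp only at hj; omega)
    have hN := nodeB hok hu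
    simp only [d] at *
    refine hL q2 a (q2 + 1) hl2 (by omega) ?_ ?_ hN
    · rw [c2]; exact y1
    · rw [c2]; exact y2

lemma two_losers {α β : ℕ → ℝ} (hJ : ∀ j, β j - α j ≤ lam j) {n1 l1 q1 n2 l2 q2 : ℕ} (q12 : q1 < q2)
    (N1 : Node α β n1 l1 q1) (L1 : Loser α β n1 l1 q1)
    (N2 : Node α β n2 l2 q2) (L2 : Loser α β n2 l2 q2) : False := by
  obtain ⟨n, a, q, h1, h2, _, h3, h4, h5⟩ := step_out hJ q12 N2.lt (Or.inl N1.lt) N1.unt N1.good N1.val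
    N2.unt N2.good N2.val L2
  exact L1 n a q h1 (by omega) h3 h4 h5

lemma main_false {α β : ℕ → ℝ} (hJ : ∀ j, β j - α j ≤ lam j)
    (hc : ∀ z ∈ XX, ∃ j, α j ≤ z ∧ z ≤ β j) {m : ℕ} (hm : ∀ n l, ¬ Touch α β m n l) : False := by
  have first : ∃ n l q, 0 < q ∧ Node α β n l q := by
    obtain ⟨l, hl⟩ := lemmaU hJ hm 0
    by_cases hf : cc l 0 = root 0 l
    · refine ⟨0, l, 1, one_pos, hl, good_fresh hf, ?_, one_pos⟩
      intro i hi
      obtain rfl : i = 0 := by omega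
      exact ⟨l, le_rfl, le_rfl⟩
    · exact nonfresh hl hf
  obtain ⟨n0, l0, q0, hq0, hN0⟩ := first
  obtain ⟨n', l', q', hq', hN', hL'⟩ := descent hc hN0
  have big : ∀ n l q, q' < q → ¬ Node α β n l q := by
    intro n l q hq hN
    obtain ⟨n2, l2, q2, h1, h2, h3⟩ := descent hc hN
    exact two_losers hJ (by omega) hN' hL' h2 h3
  obtain ⟨l, hl⟩ := lemmaU hJ hm q'
  by_cases hf : cc l q' = root q' l
  · obtain ⟨n, a, q, _, _, h, _, _, h5⟩ := step_out hJ (n1 := q') (l1 := l) (q1 := 0) (by omega) hN'.lt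
      (Or.inr rfl) hl (good_fresh hf) (fun i hi => absurd hi (by omega)) hN'.unt hN'.good hN'.val hL'
    exact big _ _ _ (h rfl) h5
  · obtain ⟨n2, l2, q2, h1, h2⟩ := nonfresh hl hf
    exact big _ _ _ h1 h2

end adversary
end
end Pico

theorem stmt16 :
    ∃ (X : Set ℝ) (x : ℝ), Picoscopic X ∧ ¬ Picoscopic (X ∪ {x}) := by
  refine ⟨Pico.XX, -5, ?_, ?_⟩
  · intro ε h0 h1
    obtain ⟨n, hn⟩ := exists_pow_lt_of_lt_one h0 (show Pico.dl < 1 by norm_num [Pico.dl])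
    refine ⟨fun k => Pico.cc k n, fun k => Pico.cc k n + Pico.len n k, ?_, ?_⟩
    · intro z hz
      obtain ⟨l, hl⟩ := hz n
      exact Set.mem_iUnion.2 ⟨l, hl⟩
    · intro k
      have h2 : Pico.dl ^ (n + 1) ≤ ε :=
        (pow_le_pow_of_le_one Pico.dl_pos.le Pico.dl_le (Nat.le_succ n)).trans hn.le
      have h3 : Pico.len n k = (Pico.dl ^ (n + 1)) ^ (Nat.factorial (k + 1)) := by
        rw [← pow_mul]; rfl
      have h4 := pow_le_pow_left₀ (pow_pos Pico.dl_pos (n + 1)).le h2 (Nat.factorial (k + 1))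
      simp only
      linarith
  · intro h
    obtain ⟨α, β, hcov, hJ⟩ := h Pico.dl Pico.dl_pos (by norm_num [Pico.dl])
    have hJ' : ∀ j, β j - α j ≤ Pico.lam j := hJ
    obtain ⟨m, hm1, hm2⟩ := Set.mem_iUnion.1 (hcov (Or.inr rfl : (-5 : ℝ) ∈ Pico.XX ∪ {-5}))
    refine Pico.main_false (m := m) hJ' ?_ ?_
    · intro z hz
      obtain ⟨j, hj⟩ := Set.mem_iUnion.1 (hcov (Or.inl hz))
      exact ⟨j, hj⟩
    · rintro n l ⟨z, z1, z2, z3, z4⟩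
      have := Pico.cc_nonneg l n
      have := hJ' m
      have := Pico.lam_le_one m
      linarith
end
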